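/- arXiv:2407.06719 — 4 statements merged into one kernel-verified Lean document; each statement's English description precedes it below -/
import Mathlib

section
/- Let f : 2^ω → 2, let G denote the set of all finitary Boolean functions g such that g ≥ π_i pointwise for some projection π_i, and write G₀ = {g ∈ G : g(0⃗) = 0}, G_M = {g ∈ G : g monotone}, and G_M0 = G₀ ∩ G_M. Then: (a) if f is discontinuous, then ⋁ ∈ ⟨{f} ∪ G⟩; (b) if f(0⃗) = 0 but f does not vanish on a neighborhood of 0⃗, then ⋁ ∈ ⟨{f} ∪ G₀⟩; (c) if f is monotone and there is a coordinatewise decreasing sequence (x⃗_q)_{q<ω} in 2^ω with limit x⃗_∞ such that f(x⃗_q) = 1 for all q and f(x⃗_∞) = 0, then ⋁ ∈ ⟨{f} ∪ G_M⟩; (d) if f is monotone, f(0⃗) = 0, and f does not vanish on a neighborhood of 0⃗, then ⋁ ∈ ⟨{f} ∪ G_M0⟩. -/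
open scoped Classical

/-- An arity: `some n` is the finite arity `n ≥ 1`; `none` is the countably infinite arity ω. -/
abbrev Arity := Option ℕ+

/-- The index set of an arity. -/
abbrev Idx : Arity → Type
  | some n => Fin (n : ℕ)
  | none => ℕ

/-- A Boolean function of some arity `1 ≤ n ≤ ω`.  The input space `Idx a → Bool`
carries the product topology (with `Bool` discrete), the product σ-algebra (= Borel),
and the coordinatewise partial order. -/
abbrev BFun : Type := Σ a : Arity, (Idx a → Bool) → Bool

/-- A clone: a set of Boolean functions of arities `1 ≤ n ≤ ω` containing all projections
and closed under composition. -/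
structure IsClone (F : Set BFun) : Prop where
  proj : ∀ (a : Arity) (i : Idx a), (⟨a, fun x => x i⟩ : BFun) ∈ F
  comp : ∀ (a b : Arity) (g : (Idx a → Bool) → Bool) (f : Idx a → (Idx b → Bool) → Bool),
      (⟨a, g⟩ : BFun) ∈ F → (∀ i, (⟨b, f i⟩ : BFun) ∈ F) →
      (⟨b, fun x => g fun i => f i x⟩ : BFun) ∈ F

/-- The clone generated by a set of Boolean functions. -/
def cloneGen (G : Set BFun) : Set BFun := ⋂₀ {F : Set BFun | IsClone F ∧ G ⊆ F}

/-- `f` has finite arity. -/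
def finitary (f : BFun) : Prop := f.1 ≠ none

/-- `f` is Borel: the preimage of `1` is a Borel set. -/
def IsBorelFun (f : BFun) : Prop := MeasurableSet {x | f.2 x = true}

/-- `f` is continuous (equivalently, depends on only finitely many coordinates). -/
def IsContFun (f : BFun) : Prop := Continuous f.2

/-- `f(0⃗) = 0`. -/
def PresBot (f : BFun) : Prop := f.2 (fun _ => false) = false

/-- `f(1⃗) = 1`. -/
def PresTop (f : BFun) : Prop := f.2 (fun _ => true) = true

/-- `f` vanishes on a neighborhood of `0⃗`, i.e. `0⃗` is not in the closure of `f⁻¹(1)`. -/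
def VanishNearBot (f : BFun) : Prop := (fun _ => false) ∉ closure {x | f.2 x = true}

/-- `f` equals `1` on a neighborhood of `1⃗`, i.e. `1⃗` is not in the closure of `f⁻¹(0)`. -/
def OneNearTop (f : BFun) : Prop := (fun _ => true) ∉ closure {x | f.2 x = false}

/-- Countably infinite disjunction `⋁ : 2^ω → 2`. -/
noncomputable def bigOr : (ℕ → Bool) → Bool := fun x => decide (∃ i, x i = true)

/-- Countably infinite conjunction `⋀ : 2^ω → 2`. -/
noncomputable def bigAnd : (ℕ → Bool) → Bool := fun x => decide (∀ i, x i = true)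

/-- `liminf : 2^ω → 2`, equal to `1` iff all but finitely many bits are `1`. -/
noncomputable def liminfF : (ℕ → Bool) → Bool := fun x => decide (∃ N, ∀ j, N ≤ j → x j = true)

/-- The finitary functions `g` lying above some projection: `g ≥ π_i` pointwise. -/
def GAll : Set BFun := {g | finitary g ∧ ∃ i : Idx g.1, ∀ x, x i ≤ g.2 x}

def G0 : Set BFun := {g ∈ GAll | PresBot g}

def GM : Set BFun := {g ∈ GAll | Monotone g.2}

def GM0 : Set BFun := {g ∈ GAll | PresBot g ∧ Monotone g.2}

/-- The point selected by `y`: `xs q` for the first `q` with `y q = 1`, and `xinf` if none. -/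
noncomputable def selPt (xs : ℕ → ℕ → Bool) (xinf : ℕ → Bool) (y : ℕ → Bool) : ℕ → Bool :=
  if h : ∃ q, y q = true then xs (Nat.find h) else xinf

/-- Extend a finite word by zeros. -/
def extZ {n : ℕ} (z : Fin n → Bool) : ℕ → Bool :=
  fun k => if h : k < n then z ⟨k, h⟩ else false

lemma selPt_none (xs : ℕ → ℕ → Bool) (xinf y : ℕ → Bool) (h : ∀ q, y q = false) :
    selPt xs xinf y = xinf := by
  unfold selPt
  rw [dif_neg]
  rintro ⟨q, hq⟩
  simp [h q] at hq

lemma selPt_first (xs : ℕ → ℕ → Bool) (xinf y : ℕ → Bool) (q : ℕ) (hq : y q = true)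
    (h : ∀ p < q, y p = false) : selPt xs xinf y = xs q := by
  unfold selPt
  have hex : ∃ q, y q = true := ⟨q, hq⟩
  rw [dif_pos hex]
  congr 1
  rw [Nat.find_eq_iff]
  exact ⟨hq, fun p hp => by simp [h p hp]⟩

lemma first_cases (y : ℕ → Bool) :
    (∀ q, y q = false) ∨ ∃ q, y q = true ∧ ∀ p < q, y p = false := by
  by_cases h : ∃ q, y q = true
  · right
    exact ⟨Nat.find h, Nat.find_spec h, fun p hp => by simpa using Nat.find_min h hp⟩
  · left
    simpa using h

lemma selPt_trunc (xs : ℕ → ℕ → Bool) (xinf y : ℕ → Bool) (i N : ℕ)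
    (hN : ∀ q, N ≤ q → xs q i = xinf i) :
    selPt xs xinf (extZ (n := N + 1) fun k => y k) i = selPt xs xinf y i := by
  rcases first_cases y with h | ⟨q, hq, h⟩
  · rw [selPt_none _ _ _ h, selPt_none]
    intro q
    simp [extZ, h]
  · rw [selPt_first _ _ _ q hq h]
    by_cases hqN : q < N + 1
    · rw [selPt_first _ _ _ q]
      · simp [extZ, hqN, hq]
      · intro p hp
        simp [extZ, h p hp]
    · rw [selPt_none, hN q (by omega)]
      intro p
      by_cases hp : p < N + 1
      · simp [extZ, h p (by omega)]
      · simp [extZ, hp]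

lemma selPt_mono (xs : ℕ → ℕ → Bool) (xinf : ℕ → Bool) (ha : Antitone xs)
    (hl : ∀ q, xinf ≤ xs q) : Monotone (selPt xs xinf) := by
  intro y y' hy
  rcases first_cases y' with h' | ⟨q', hq', h'⟩
  · rw [selPt_none _ _ _ h', selPt_none]
    intro q
    have := hy q
    rw [h' q] at this
    exact Bool.eq_false_of_le_false this
  · rw [selPt_first _ _ _ q' hq' h']
    rcases first_cases y with h | ⟨q, hq, h⟩
    · rw [selPt_none _ _ _ h]
      exact hl _
    · rw [selPt_first _ _ _ q hq h]
      apply ha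
      by_contra hlt
      have := hy q
      rw [h' q (by omega), hq] at this
      exact Bool.noConfusion (Bool.eq_false_of_le_false this)

/-- Pointwise identity behind all four parts. -/
lemma core_clone (C : Set BFun) (hC : IsClone C) (f : (ℕ → Bool) → Bool)
    (hf : (⟨none, f⟩ : BFun) ∈ C) (xs : ℕ → ℕ → Bool) (xinf : ℕ → Bool)
    (ht : Filter.Tendsto xs Filter.atTop (nhds xinf)) (v : Bool)
    (h0 : f xinf = v) (h1 : ∀ q, f (xs q) = !v)
    (hg : (⟨some 2, fun z : Fin 2 → Bool => z 0 || xor v (z 1)⟩ : BFun) ∈ C)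
    (hfin : ∀ i N : ℕ, (⟨some ⟨N + 1, Nat.succ_pos N⟩,
      fun z : Fin (N + 1) → Bool => z 0 || selPt xs xinf (extZ z) i⟩ : BFun) ∈ C) :
    (⟨none, bigOr⟩ : BFun) ∈ C := by
  have hbit : ∀ i : ℕ, (⟨none, fun y : ℕ → Bool => y 0 || selPt xs xinf y i⟩ : BFun) ∈ C := by
    intro i
    have hti := (tendsto_pi_nhds.1 ht) i
    rw [nhds_discrete, Filter.tendsto_pure, Filter.eventually_atTop] at hti
    obtain ⟨N, hN⟩ := hti
    have := hC.comp (some ⟨N + 1, Nat.succ_pos N⟩) none _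
      (fun (k : Fin (N + 1)) (y : ℕ → Bool) => y k) (hfin i N) (fun k => hC.proj none (k : ℕ))
    convert this using 3 with y
    have hy := selPt_trunc xs xinf y i N hN
    exact congrArg (fun b => y 0 || b) hy.symm
  have hF := hC.comp none none f _ hf hbit
  have := hC.comp (some 2) none _
    (fun (k : Fin 2) => if k = 0 then (fun y : ℕ → Bool => y 0)
      else fun y : ℕ → Bool => f fun i => y 0 || selPt xs xinf y i) hg (by
      intro (k : Fin 2)
      fin_cases k
      · exact hC.proj none (0 : ℕ)
      · exact hF)
  have heq : (bigOr : (ℕ → Bool) → Bool) = fun y =>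
      y 0 || xor v (f fun i => y 0 || selPt xs xinf y i) := by
    funext y
    cases hy : y 0
    · simp only [Bool.false_or]
      change bigOr y = xor v (f (selPt xs xinf y))
      rcases first_cases y with h | ⟨q, hq, h⟩
      · rw [selPt_none _ _ _ h, h0]
        simp [bigOr, h]
      · rw [selPt_first _ _ _ q hq h, h1]
        have : bigOr y = true := by simpa [bigOr] using ⟨q, hq⟩
        rw [this]
        cases v <;> rfl
    · simp only [Bool.true_or]
      simpa [bigOr] using ⟨0, hy⟩
  rw [heq]
  exact this

/-- Core lemma for the generated clone. -/
lemma core_gen (G : Set BFun) (f : (ℕ → Bool) → Bool)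
    (xs : ℕ → ℕ → Bool) (xinf : ℕ → Bool)
    (ht : Filter.Tendsto xs Filter.atTop (nhds xinf)) (v : Bool)
    (h0 : f xinf = v) (h1 : ∀ q, f (xs q) = !v)
    (hg : (⟨some 2, fun z : Fin 2 → Bool => z 0 || xor v (z 1)⟩ : BFun) ∈ G)
    (hfin : ∀ i N : ℕ, (⟨some ⟨N + 1, Nat.succ_pos N⟩,
      fun z : Fin (N + 1) → Bool => z 0 || selPt xs xinf (extZ z) i⟩ : BFun) ∈ G) :
    (⟨none, bigOr⟩ : BFun) ∈ cloneGen ({(⟨none, f⟩ : BFun)} ∪ G) := by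
  rintro C ⟨hC, hsub⟩
  exact core_clone C hC f (hsub (Or.inl rfl)) xs xinf ht v h0 h1 (hsub (Or.inr hg))
    (fun i N => hsub (Or.inr (hfin i N)))

lemma two_mem_GAll (v : Bool) :
    (⟨some 2, fun z : Fin 2 → Bool => z 0 || xor v (z 1)⟩ : BFun) ∈ GAll := by
  refine ⟨by simp [finitary], (0 : Fin 2), fun x => ?_⟩
  exact Bool.left_le_or _ _

lemma two_mono :
    Monotone (fun z : Fin 2 → Bool => z 0 || xor false (z 1)) := by
  intro z z' h
  have h0 := h 0
  have h1 := h 1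
  revert h0 h1
  dsimp only
  cases z 0 <;> cases z 1 <;> cases z' 0 <;> cases z' 1 <;> decide

lemma fin_mem_GAll (xs : ℕ → ℕ → Bool) (xinf : ℕ → Bool) (i N : ℕ) :
    (⟨some ⟨N + 1, Nat.succ_pos N⟩,
      fun z : Fin (N + 1) → Bool => z 0 || selPt xs xinf (extZ z) i⟩ : BFun) ∈ GAll := by
  refine ⟨by simp [finitary], (0 : Fin (N + 1)), fun x => ?_⟩
  exact Bool.left_le_or _ _

lemma bool_or_le : ∀ a b c d : Bool, a ≤ b → c ≤ d → (a || c) ≤ (b || d) := by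
  decide

lemma limit_le (xs : ℕ → ℕ → Bool) (xinf : ℕ → Bool) (ha : Antitone xs)
    (ht : Filter.Tendsto xs Filter.atTop (nhds xinf)) (q : ℕ) : xinf ≤ xs q := by
  intro i
  have hti := (tendsto_pi_nhds.1 ht) i
  rw [nhds_discrete, Filter.tendsto_pure] at hti
  obtain ⟨p, hp, hqp⟩ := (hti.and (Filter.eventually_ge_atTop q)).exists
  rw [← hp]
  exact ha hqp i

lemma fin_mono (xs : ℕ → ℕ → Bool) (xinf : ℕ → Bool) (ha : Antitone xs)
    (hl : ∀ q, xinf ≤ xs q) (i N : ℕ) :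
    Monotone (fun z : Fin (N + 1) → Bool => z 0 || selPt xs xinf (extZ z) i) := by
  intro z z' h
  have h0 := h 0
  have hext : extZ z ≤ extZ z' := by
    intro k
    unfold extZ
    split_ifs with hk
    · exact h _
    · exact le_rfl
  have h1 := selPt_mono xs xinf ha hl hext i
  exact bool_or_le _ _ _ _ h0 h1

lemma fin_bot (xs : ℕ → ℕ → Bool) (i N : ℕ) :
    (fun z : Fin (N + 1) → Bool => z 0 || selPt xs (fun _ => false) (extZ z) i)
      (fun _ => false) = false := by
  simp only [Bool.false_or]
  rw [selPt_none]
  intro q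
  simp [extZ]

/-- "Wadge's lemma" style dichotomies: countable disjunction `⋁` is the minimally complex
discontinuous function.  (a) If `f : 2^ω → 2` is discontinuous then `⋁ ∈ ⟨{f} ∪ G⟩`;
(b) if `f(0⃗) = 0` but `f` does not vanish on a neighborhood of `0⃗` then `⋁ ∈ ⟨{f} ∪ G₀⟩`;
(c) if `f` is monotone and some coordinatewise decreasing sequence with `f = 1` converges
to a point where `f = 0`, then `⋁ ∈ ⟨{f} ∪ G_M⟩`;
(d) if `f` is monotone, `f(0⃗) = 0`, and `f` does not vanish on a neighborhood of `0⃗`,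
then `⋁ ∈ ⟨{f} ∪ G_M0⟩`. -/
theorem bigOr_mem_cloneGen_of_discontinuous (f : (ℕ → Bool) → Bool) :
    (¬ Continuous f →
      (⟨none, bigOr⟩ : BFun) ∈ cloneGen ({(⟨none, f⟩ : BFun)} ∪ GAll)) ∧
    (f (fun _ => false) = false → (fun _ => false) ∈ closure {x | f x = true} →
      (⟨none, bigOr⟩ : BFun) ∈ cloneGen ({(⟨none, f⟩ : BFun)} ∪ G0)) ∧
    (Monotone f →
      ∀ (xs : ℕ → ℕ → Bool) (xinf : ℕ → Bool), Antitone xs →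
        Filter.Tendsto xs Filter.atTop (nhds xinf) →
        (∀ q, f (xs q) = true) → f xinf = false →
      (⟨none, bigOr⟩ : BFun) ∈ cloneGen ({(⟨none, f⟩ : BFun)} ∪ GM)) ∧
    (Monotone f → f (fun _ => false) = false →
        (fun _ => false) ∈ closure {x | f x = true} →
      (⟨none, bigOr⟩ : BFun) ∈ cloneGen ({(⟨none, f⟩ : BFun)} ∪ GM0)) := by
  refine ⟨?_, ?_, ?_, ?_⟩
  · intro hc
    obtain ⟨x, hx⟩ : ∃ x, x ∈ closure {y | f y = !(f x)} := by
      by_contra hno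
      push Not at hno
      apply hc
      rw [continuous_iff_continuousAt]
      intro x
      have hev : (fun _ => f x) =ᶠ[nhds x] f := by
        have := hno x
        rw [mem_closure_iff_frequently, Filter.not_frequently] at this
        filter_upwards [this] with y hy
        revert hy
        cases f x <;> cases f y <;> simp
      exact continuousAt_const.congr hev
    obtain ⟨xs, hxs, ht⟩ := mem_closure_iff_seq_limit.1 hx
    exact core_gen _ f xs x ht (f x) rfl hxs (two_mem_GAll _) (fin_mem_GAll xs x)
  · intro h0 hx
    obtain ⟨xs, hxs, ht⟩ := mem_closure_iff_seq_limit.1 hx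
    exact core_gen _ f xs _ ht false h0 hxs ⟨two_mem_GAll _, rfl⟩
      (fun i N => ⟨fin_mem_GAll xs _ i N, fin_bot xs i N⟩)
  · intro _ xs xinf ha ht h1 h0
    exact core_gen _ f xs xinf ht false h0 h1 ⟨two_mem_GAll _, two_mono⟩
      (fun i N => ⟨fin_mem_GAll xs _ i N, fin_mono xs xinf ha (limit_le xs _ ha ht) i N⟩)
  · intro hm h0 hx
    obtain ⟨us, hus, hut⟩ := mem_closure_iff_seq_limit.1 hx
    let xs : ℕ → ℕ → Bool := fun q i => decide (q ≤ i)
    have ha : Antitone xs := by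
      intro p q hpq i
      simp only [xs]
      by_cases hq : q ≤ i
      · simp [hq, hpq.trans hq]
      · simp [hq]
    have ht : Filter.Tendsto xs Filter.atTop (nhds (fun _ => false)) := by
      rw [tendsto_pi_nhds]
      intro i
      rw [nhds_discrete, Filter.tendsto_pure]
      filter_upwards [Filter.eventually_gt_atTop i] with q hq
      simp [xs, hq]
    have h1 : ∀ q, f (xs q) = true := by
      intro q
      have hev : ∀ᶠ n in Filter.atTop, ∀ i ∈ Finset.range q, us n i = false := by
        rw [Filter.eventually_all_finset]
        intro i _
        have hti := (tendsto_pi_nhds.1 hut) i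
        rwa [nhds_discrete, Filter.tendsto_pure] at hti
      obtain ⟨n, hn⟩ := hev.exists
      have hle : us n ≤ xs q := by
        intro i
        by_cases hi : q ≤ i
        · simp [xs, hi]
        · rw [hn i (by simpa using hi)]
          exact Bool.false_le _
      have := hm hle
      rw [show f (us n) = true from hus n] at this
      exact Bool.eq_true_of_true_le this
    exact core_gen _ f xs _ ht false h0 h1 ⟨two_mem_GAll _, rfl, two_mono⟩
      (fun i N => ⟨fin_mem_GAll xs _ i N, fin_bot xs i N,
        fin_mono xs _ ha (limit_le xs _ ha ht) i N⟩)
end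

section
/- There are exactly two Borel clones whose finitary restriction is the set of all finitary Boolean functions, namely: (i) the clone of all Borel Boolean functions of arities 1 ≤ n ≤ ω, and (ii) the clone of all continuous Boolean functions of arities 1 ≤ n ≤ ω. That is, these two sets are distinct Borel clones whose finitary restriction is all finitary functions, and every Borel clone whose finitary restriction is all finitary functions equals one of them. -/
open scoped Classical

/-- The set of all Borel Boolean functions of arities `1 ≤ n ≤ ω`. -/
def BorelClass : Set BFun := {f | IsBorelFun f}

/-- The set of all continuous Boolean functions of arities `1 ≤ n ≤ ω`. -/
def ContClass : Set BFun := {f | IsContFun f}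

/-- The finitary restriction of a class of Boolean functions. -/
def finRes (F : Set BFun) : Set BFun := {f ∈ F | finitary f}


theorem aux_borel_iff (f : BFun) : IsBorelFun f ↔ Measurable f.2 := by
  constructor
  · intro h
    exact measurable_to_bool h
  · intro h
    exact h (MeasurableSet.singleton true)

theorem aux_cont_borel (f : BFun) (h : IsContFun f) : IsBorelFun f := by
  rw [aux_borel_iff]
  obtain ⟨a, f⟩ := f
  cases a with
  | none => exact Continuous.measurable (α := ℕ → Bool) h
  | some n => exact Continuous.measurable (α := Fin n → Bool) h

theorem aux_fin_cont (f : BFun) (h : finitary f) : IsContFun f := by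
  obtain ⟨a, f⟩ := f
  cases a with
  | none => exact absurd rfl h
  | some n => exact continuous_of_discreteTopology (α := Fin n → Bool)

theorem aux_loc (f : (ℕ → Bool) → Bool) (x : ℕ → Bool) (n : ℕ)
    (h : ∀ z : ℕ → Bool, (∀ i < n, z i = x i) → f z = f x) : ContinuousAt f x := by
  have h1 : ∀ᶠ z : ℕ → Bool in nhds x, ∀ i ∈ Finset.range n, z i = x i := by
    rw [Filter.eventually_all_finset]
    intro i _
    have := (continuous_apply (A := fun _ : ℕ => Bool) i).continuousAt (x := x)
    exact this.eventually (p := fun b => b = x i) (by rw [nhds_discrete]; simp)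
  have h2 : f =ᶠ[nhds x] fun _ => f x := by
    filter_upwards [h1] with z hz
    exact h z (fun i hi => hz i (Finset.mem_range.2 hi))
  exact continuousAt_const.congr h2.symm

theorem aux_dep (f : (ℕ → Bool) → Bool) (h : Continuous f) :
    ∃ n : ℕ, ∀ x y : ℕ → Bool, (∀ i < n, x i = y i) → f x = f y := by
  by_contra! hc
  choose u v huv hne using hc
  obtain ⟨a, φ, hφ, ha⟩ := CompactSpace.tendsto_subseq u
  have hv : Filter.Tendsto (v ∘ φ) Filter.atTop (nhds a) := by
    rw [tendsto_pi_nhds] at ha ⊢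
    intro i
    refine (ha i).congr' ?_
    filter_upwards [Filter.eventually_gt_atTop i] with k hk
    exact huv (φ k) i (lt_of_lt_of_le hk (hφ.le_apply))
  have e1 := (h.tendsto a).comp ha
  have e2 := (h.tendsto a).comp hv
  rw [nhds_discrete, Filter.tendsto_pure] at e1 e2
  obtain ⟨k, h1, h2⟩ := (e1.and e2).exists
  exact hne (φ k) (h1.trans h2.symm)

section
variable {F : Set BFun}

theorem aux_dep_mem (hF : IsClone F) (hfin : ∀ f : BFun, finitary f → f ∈ F)
    (f : (ℕ → Bool) → Bool) (n : ℕ)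
    (h : ∀ x y : ℕ → Bool, (∀ i < n, x i = y i) → f x = f y) : (⟨none, f⟩ : BFun) ∈ F := by
  let m : ℕ+ := ⟨n + 1, Nat.succ_pos n⟩
  let g : (Idx (some m) → Bool) → Bool :=
    fun z => f (fun i => if hi : i < n + 1 then z (⟨i, hi⟩ : Fin (n+1)) else false)
  have hg : (⟨some m, g⟩ : BFun) ∈ F := hfin _ (by simp [finitary])
  have := hF.comp (some m) none g (fun i x => x (i : Fin (n+1)).val) hg
    (fun i => hF.proj none (i : Fin (n+1)).val)
  convert this using 2
  funext x
  apply h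
  intro i hi
  simp [Nat.lt_succ_of_lt hi]

theorem aux_cont_mem (hF : IsClone F) (hfin : ∀ f : BFun, finitary f → f ∈ F)
    (f : BFun) (h : IsContFun f) : f ∈ F := by
  obtain ⟨a, f⟩ := f
  cases a with
  | some n => exact hfin _ (by simp [finitary])
  | none =>
    obtain ⟨n, hn⟩ := aux_dep f h
    exact aux_dep_mem hF hfin f n hn

theorem aux_not_mem (hF : IsClone F) (hfin : ∀ f : BFun, finitary f → f ∈ F)
    (f : (ℕ → Bool) → Bool) (h : (⟨none, f⟩ : BFun) ∈ F) :
    (⟨none, fun x => !(f x)⟩ : BFun) ∈ F := by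
  let g : (Idx (some 1) → Bool) → Bool := fun z => !(z (0 : Fin 1))
  have hg : (⟨some 1, g⟩ : BFun) ∈ F := hfin _ (by simp [finitary])
  exact hF.comp (some 1) none g (fun _ => f) hg (fun _ => h)

theorem aux_borel_mem (hF : IsClone F) (hfin : ∀ f : BFun, finitary f → f ∈ F)
    (hor : (⟨none, bigOr⟩ : BFun) ∈ F) (f : BFun) (h : IsBorelFun f) : f ∈ F := by
  obtain ⟨a, f⟩ := f
  cases a with
  | some n => exact hfin _ (by simp [finitary])
  | none =>
    let M : MeasurableSpace (ℕ → Bool) :=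
      { MeasurableSet' := fun S => (⟨none, fun x => decide (x ∈ S)⟩ : BFun) ∈ F
        measurableSet_empty := by
          apply aux_dep_mem hF hfin _ 0
          simp
        measurableSet_compl := by
          intro S hS
          have := aux_not_mem hF hfin _ hS
          convert this using 2
          funext x
          by_cases hx : x ∈ S <;> simp [hx]
        measurableSet_iUnion := by
          intro S hS
          have := hF.comp none none bigOr (fun i x => decide (x ∈ S i)) hor hS
          convert this using 2
          funext x
          simp [bigOr] }
    have hM : (MeasurableSpace.pi : MeasurableSpace (ℕ → Bool)) ≤ M := by
      refine iSup_le fun i => ?_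
      rintro S ⟨t, -, rfl⟩
      change (⟨none, _⟩ : BFun) ∈ F
      apply aux_dep_mem hF hfin _ (i + 1)
      intro x y hxy
      simp [hxy i (Nat.lt_succ_self i)]
    have hM' : ∀ S : Set (ℕ → Bool), @MeasurableSet _ M S →
        (⟨none, fun x => decide (x ∈ S)⟩ : BFun) ∈ F := fun _ h => h
    have := hM' _ (hM {x : ℕ → Bool | f x = true} h)
    convert this using 2
    funext x
    simp

theorem aux_or_mem (hF : IsClone F) (hfin : ∀ f : BFun, finitary f → f ∈ F)
    (f : (ℕ → Bool) → Bool) (hf : (⟨none, f⟩ : BFun) ∈ F) (x : ℕ → Bool) (hx : f x = false)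
    (u : ℕ → ℕ → Bool) (hu : ∀ n, ∀ i < n, u n i = x i) (hfu : ∀ n, f (u n) = true) :
    (⟨none, bigOr⟩ : BFun) ∈ F := by
  let g : ℕ → (ℕ → Bool) → Bool := fun i y =>
    if h : ∃ j, j ≤ i ∧ y j = true then u (Nat.find h) i else x i
  have hg : ∀ i, (⟨none, g i⟩ : BFun) ∈ F := by
    intro i
    apply aux_dep_mem hF hfin _ (i + 1)
    intro y z hyz
    have : (fun j => j ≤ i ∧ y j = true) = (fun j => j ≤ i ∧ z j = true) := by
      funext j
      by_cases hj : j ≤ i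
      · simp [hyz j (Nat.lt_succ_of_le hj)]
      · simp [hj]
    have key : ∀ (p q : ℕ → Prop) [DecidablePred p] [DecidablePred q]
        [Decidable (∃ j, p j)] [Decidable (∃ j, q j)], p = q →
        (if h : ∃ j, p j then u (Nat.find h) i else x i)
          = (if h : ∃ j, q j then u (Nat.find h) i else x i) := by
      rintro p _ i1 i2 i3 i4 rfl
      have hi : i1 = i2 := Subsingleton.elim _ _
      have hi' : i3 = i4 := Subsingleton.elim _ _
      subst hi hi'
      rfl
    exact key _ _ this
  have := hF.comp none none f g hf hg
  convert this using 2
  funext y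
  by_cases h : ∃ j, y j = true
  · have e : (fun i => g i y) = u (Nat.find h) := by
      funext i
      by_cases hi : ∃ j, j ≤ i ∧ y j = true
      · have : Nat.find hi = Nat.find h := by
          apply le_antisymm
          · apply Nat.find_min'
            exact ⟨(Nat.find_min' h (Nat.find_spec hi).2).trans (Nat.find_spec hi).1,
              Nat.find_spec h⟩
          · exact Nat.find_min' h (Nat.find_spec hi).2
        simp only [g, dif_pos hi, this]
      · simp only [g, dif_neg hi]
        refine (hu _ _ ?_).symm
        by_contra hlt
        exact hi ⟨Nat.find h, not_lt.1 hlt, Nat.find_spec h⟩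
    have e2 : f (fun i => g i y) = true := by rw [e]; exact hfu _
    exact (by simpa [bigOr] using h : bigOr y = true).trans e2.symm
  · have e : (fun i => g i y) = x := by
      funext i
      have hi : ¬ ∃ j, j ≤ i ∧ y j = true := fun ⟨j, hj⟩ => h ⟨j, hj.2⟩
      simp only [g, dif_neg hi]
    have e2 : f (fun i => g i y) = false := by rw [e]; exact hx
    exact (by simpa [bigOr] using h : bigOr y = false).trans e2.symm

theorem aux_discont (hF : IsClone F) (hfin : ∀ f : BFun, finitary f → f ∈ F)
    (f : BFun) (hf : f ∈ F) (hc : ¬ IsContFun f) : (⟨none, bigOr⟩ : BFun) ∈ F := by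
  obtain ⟨a, f⟩ := f
  cases a with
  | some n => exact absurd (aux_fin_cont _ (by simp [finitary])) hc
  | none =>
    change ¬ Continuous f at hc
    rw [continuous_iff_continuousAt] at hc
    push Not at hc
    obtain ⟨x, hx⟩ := hc
    have : ∀ n : ℕ, ∃ z : ℕ → Bool, (∀ i < n, z i = x i) ∧ f z ≠ f x := by
      intro n
      by_contra! hn
      exact hx (aux_loc f x n hn)
    choose u hu hfu using this
    cases hfx : f x with
    | false =>
      exact aux_or_mem hF hfin f hf x hfx u hu (fun n => by simpa [hfx] using hfu n)
    | true =>
      exact aux_or_mem hF hfin _ (aux_not_mem hF hfin f hf) x (by simp [hfx]) u hu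
        (fun n => by simpa [hfx] using hfu n)

end

theorem aux_borel_clone : IsClone BorelClass where
  proj a i := (aux_borel_iff _).2 (measurable_pi_apply i)
  comp a b g f hg hf := (aux_borel_iff _).2
    (((aux_borel_iff _).1 hg).comp (measurable_pi_lambda _ fun i => (aux_borel_iff _).1 (hf i)))

theorem aux_cont_clone : IsClone ContClass where
  proj a i := continuous_apply i
  comp a b g f hg hf := Continuous.comp (g := g) hg (continuous_pi fun i => hf i)

theorem aux_or_borel : (⟨none, bigOr⟩ : BFun) ∈ BorelClass := by
  change MeasurableSet {x : ℕ → Bool | bigOr x = true}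
  have : {x : ℕ → Bool | bigOr x = true} = ⋃ i, (fun x : ℕ → Bool => x i) ⁻¹' {true} := by
    ext x
    simp [bigOr]
  rw [this]
  exact MeasurableSet.iUnion fun i => measurable_pi_apply i (MeasurableSet.singleton true)

theorem aux_or_cont : (⟨none, bigOr⟩ : BFun) ∉ ContClass := by
  intro h
  obtain ⟨n, hn⟩ := aux_dep bigOr h
  have := hn (fun _ => false) (fun i => decide (n ≤ i)) (by simp)
  have h2 : ∃ i, n ≤ i := ⟨n, le_rfl⟩
  simp [bigOr, h2] at this

/-- There are exactly two Borel clones whose finitary restriction is all finitary Boolean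
functions: the clone of all Borel functions and the clone of all continuous functions. -/
theorem borel_clones_over_all_finitary :
    (IsClone BorelClass ∧ finRes BorelClass = {f | finitary f}) ∧
    (IsClone ContClass ∧ ContClass ⊆ BorelClass ∧ finRes ContClass = {f | finitary f}) ∧
    BorelClass ≠ ContClass ∧
    (∀ F : Set BFun, IsClone F → F ⊆ BorelClass → finRes F = {f | finitary f} →
      F = BorelClass ∨ F = ContClass) := by
  refine ⟨⟨aux_borel_clone, ?_⟩, ⟨aux_cont_clone, aux_cont_borel, ?_⟩, ?_, ?_⟩
  · ext f
    exact ⟨fun h => h.2, fun h => ⟨aux_cont_borel _ (aux_fin_cont f h), h⟩⟩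
  · ext f
    exact ⟨fun h => h.2, fun h => ⟨aux_fin_cont f h, h⟩⟩
  · intro h
    exact aux_or_cont (h ▸ aux_or_borel)
  · intro F hF hB hR
    have hfin : ∀ f : BFun, finitary f → f ∈ F := by
      intro f hf
      have : f ∈ finRes F := by rw [hR]; exact hf
      exact this.1
    by_cases hc : F ⊆ ContClass
    · right
      exact Set.Subset.antisymm hc (aux_cont_mem hF hfin)
    · left
      obtain ⟨f, hf, hfc⟩ := Set.not_subset.1 hc
      exact Set.Subset.antisymm hB
        (aux_borel_mem hF hfin (aux_discont hF hfin f hf hfc))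
end

section
/- There are exactly nine Borel clones whose finitary restriction is the set of all finitary monotone Boolean functions f with f(0⃗) = 0 and f(1⃗) = 1, namely the sets of all monotone Borel f (arities 1 ≤ n ≤ ω) with f(0⃗) = 0 and f(1⃗) = 1 satisfying additionally, respectively: (i) no further condition; (ii) f equals 1 on a neighborhood of 1⃗; (iii) increasing-continuity; (iv) f vanishes on a neighborhood of 0⃗; (v) decreasing-continuity; (vi) f vanishes on a neighborhood of 0⃗ and f equals 1 on a neighborhood of 1⃗; (vii) increasing-continuity and f vanishes on a neighborhood of 0⃗; (viii) decreasing-continuity and f equals 1 on a neighborhood of 1⃗; (ix) continuity. -/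
open scoped Classical

/-- `f` is increasing-continuous: monotone and `f(sup_q x_q) = sup_q f(x_q)` for every
coordinatewise increasing ω-sequence of inputs. -/
def IncrCont (f : BFun) : Prop :=
  Monotone f.2 ∧ ∀ x : ℕ → Idx f.1 → Bool, Monotone x →
    f.2 (fun i => decide (∃ q, x q i = true)) = decide (∃ q, f.2 (x q) = true)

/-- `f` is decreasing-continuous: monotone and `f(inf_q x_q) = inf_q f(x_q)` for every
coordinatewise decreasing ω-sequence of inputs. -/
def DecrCont (f : BFun) : Prop :=
  Monotone f.2 ∧ ∀ x : ℕ → Idx f.1 → Bool, Antitone x →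
    f.2 (fun i => decide (∀ q, x q i = true)) = decide (∀ q, f.2 (x q) = true)

/-- The base class: monotone Borel `f` with `f(0⃗) = 0` and `f(1⃗) = 1`. -/
def Base : Set BFun := {f | IsBorelFun f ∧ Monotone f.2 ∧ PresBot f ∧ PresTop f}

def P1 : Set BFun := Base
def P2 : Set BFun := {f ∈ Base | OneNearTop f}
def P3 : Set BFun := {f ∈ Base | IncrCont f}
def P4 : Set BFun := {f ∈ Base | VanishNearBot f}
def P5 : Set BFun := {f ∈ Base | DecrCont f}
def P6 : Set BFun := {f ∈ Base | VanishNearBot f ∧ OneNearTop f}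
def P7 : Set BFun := {f ∈ Base | IncrCont f ∧ VanishNearBot f}
def P8 : Set BFun := {f ∈ Base | DecrCont f ∧ OneNearTop f}
def P9 : Set BFun := {f ∈ Base | IsContFun f}


/-! ### Positive Borel sets and the positive Lusin separation theorem -/

/-- The σ-lattice of sets generated by the coordinate sets. -/
inductive PosSet {ι : Type} : Set (ι → Bool) → Prop
  | coord (i : ι) : PosSet {x | x i = true}
  | univ : PosSet Set.univ
  | empty : PosSet ∅
  | iUnion (s : ℕ → Set (ι → Bool)) : (∀ n, PosSet (s n)) → PosSet (⋃ n, s n)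
  | iInter (s : ℕ → Set (ι → Bool)) : (∀ n, PosSet (s n)) → PosSet (⋂ n, s n)

def PosSeparable {ι : Type} (s t : Set (ι → Bool)) : Prop :=
  ∃ u, s ⊆ u ∧ Disjoint t u ∧ PosSet u

section Separation
open Set PiNat Function

theorem PosSeparable.iUnion {ι : Type} {s t : ℕ → Set (ι → Bool)}
    (h : ∀ m n, PosSeparable (s m) (t n)) : PosSeparable (⋃ n, s n) (⋃ m, t m) := by
  choose u hsu htu hu using h
  refine ⟨⋃ m, ⋂ n, u m n, ?_, ?_, ?_⟩
  · refine iUnion_subset fun m => subset_iUnion_of_subset m ?_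
    exact subset_iInter fun n => hsu m n
  · simp_rw [disjoint_iUnion_left, disjoint_iUnion_right]
    intro n m
    apply Disjoint.mono_right _ (htu m n)
    apply iInter_subset
  · refine PosSet.iUnion _ fun m => ?_
    exact PosSet.iInter _ fun n => hu m n

theorem posSeparable_range {ι : Type} {f g : (ℕ → ℕ) → ι → Bool} (hf : Continuous f)
    (hg : Continuous g) (h : ∀ p q, ¬ f p ≤ g q) : PosSeparable (range f) (range g) := by
  by_contra hfg
  have I : ∀ n x y, ¬PosSeparable (f '' cylinder x n) (g '' cylinder y n) →
      ∃ x' y', x' ∈ cylinder x n ∧ y' ∈ cylinder y n ∧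
      ¬PosSeparable (f '' cylinder x' (n + 1)) (g '' cylinder y' (n + 1)) := by
    intro n x y
    contrapose!
    intro H
    rw [← iUnion_cylinder_update x n, ← iUnion_cylinder_update y n, image_iUnion, image_iUnion]
    refine PosSeparable.iUnion fun i j => ?_
    exact H _ _ (update_mem_cylinder _ _ _) (update_mem_cylinder _ _ _)
  let A :=
    { p : ℕ × (ℕ → ℕ) × (ℕ → ℕ) //
      ¬PosSeparable (f '' cylinder p.2.1 p.1) (g '' cylinder p.2.2 p.1) }
  have : ∀ p : A, ∃ q : A,
      q.1.1 = p.1.1 + 1 ∧ q.1.2.1 ∈ cylinder p.1.2.1 p.1.1 ∧ q.1.2.2 ∈ cylinder p.1.2.2 p.1.1 := by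
    rintro ⟨⟨n, x, y⟩, hp⟩
    rcases I n x y hp with ⟨x', y', hx', hy', h'⟩
    exact ⟨⟨⟨n + 1, x', y'⟩, h'⟩, rfl, hx', hy'⟩
  choose F hFn hFx hFy using this
  let p0 : A := ⟨⟨0, fun _ => 0, fun _ => 0⟩, by simp [hfg]⟩
  let p : ℕ → A := fun n => F^[n] p0
  have prec : ∀ n, p (n + 1) = F (p n) := fun n => by simp only [p, iterate_succ', Function.comp]
  have pn_fst : ∀ n, (p n).1.1 = n := fun n ↦ by
    induction n with
    | zero => rfl
    | succ n IH => simp only [prec, hFn, IH]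
  have Ix : ∀ m n, m + 1 ≤ n → (p n).1.2.1 m = (p (m + 1)).1.2.1 m := by
    intro m
    apply Nat.le_induction
    · rfl
    intro n hmn IH
    have I : (F (p n)).val.snd.fst m = (p n).val.snd.fst m := by
      apply hFx (p n) m
      rw [pn_fst]
      exact hmn
    rw [prec, I, IH]
  have Iy : ∀ m n, m + 1 ≤ n → (p n).1.2.2 m = (p (m + 1)).1.2.2 m := by
    intro m
    apply Nat.le_induction
    · rfl
    intro n hmn IH
    have I : (F (p n)).val.snd.snd m = (p n).val.snd.snd m := by
      apply hFy (p n) m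
      rw [pn_fst]
      exact hmn
    rw [prec, I, IH]
  set x : ℕ → ℕ := fun n => (p (n + 1)).1.2.1 n with hx
  set y : ℕ → ℕ := fun n => (p (n + 1)).1.2.2 n with hy
  have M : ∀ n, ¬PosSeparable (f '' cylinder x n) (g '' cylinder y n) := by
    intro n
    convert! (p n).2 using 3
    · rw [pn_fst, ← mem_cylinder_iff_eq, mem_cylinder_iff]
      intro i hi
      rw [hx]
      exact (Ix i n hi).symm
    · rw [pn_fst, ← mem_cylinder_iff_eq, mem_cylinder_iff]
      intro i hi
      rw [hy]
      exact (Iy i n hi).symm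
  obtain ⟨i, hi⟩ : ∃ i, ¬ (f x i ≤ g y i) := by
    have := h x y
    rwa [Pi.le_def, not_forall] at this
  have hi1 : f x i = true ∧ g y i = false := by
    revert hi; cases f x i <;> cases g y i <;> simp
  let u : Set (ι → Bool) := {z | z i = true}
  let v : Set (ι → Bool) := {z | z i = false}
  have u_open : IsOpen u := by
    have hc : Continuous (fun z : ι → Bool => z i) := continuous_apply i
    exact (isOpen_discrete ({true} : Set Bool)).preimage hc
  have v_open : IsOpen v := by
    have hc : Continuous (fun z : ι → Bool => z i) := continuous_apply i
    exact (isOpen_discrete ({false} : Set Bool)).preimage hc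
  have xu : f x ∈ u := hi1.1
  have yv : g y ∈ v := hi1.2
  have huv : Disjoint u v := by
    rw [Set.disjoint_left]
    intro z hz hz'
    simp only [u, v, mem_ofPred_eq] at hz hz'
    simp [hz] at hz'
  let : MetricSpace (ℕ → ℕ) := metricSpaceNatNat
  obtain ⟨εx, εxpos, hεx⟩ : ∃ (εx : ℝ), εx > 0 ∧ Metric.ball x εx ⊆ f ⁻¹' u := by
    apply Metric.mem_nhds_iff.1
    exact hf.continuousAt.preimage_mem_nhds (u_open.mem_nhds xu)
  obtain ⟨εy, εypos, hεy⟩ : ∃ (εy : ℝ), εy > 0 ∧ Metric.ball y εy ⊆ g ⁻¹' v := by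
    apply Metric.mem_nhds_iff.1
    exact hg.continuousAt.preimage_mem_nhds (v_open.mem_nhds yv)
  obtain ⟨n, hn⟩ : ∃ n : ℕ, (1 / 2 : ℝ) ^ n < min εx εy :=
    exists_pow_lt_of_lt_one (lt_min εxpos εypos) (by norm_num)
  have B : PosSeparable (f '' cylinder x n) (g '' cylinder y n) := by
    refine ⟨u, ?_, ?_, PosSet.coord i⟩
    · rw [image_subset_iff]
      apply Subset.trans _ hεx
      intro z hz
      rw [mem_cylinder_iff_dist_le] at hz
      exact hz.trans_lt (hn.trans_le (min_le_left _ _))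
    · refine Disjoint.mono_left ?_ huv.symm
      change g '' cylinder y n ⊆ v
      rw [image_subset_iff]
      apply Subset.trans _ hεy
      intro z hz
      rw [mem_cylinder_iff_dist_le] at hz
      exact hz.trans_lt (hn.trans_le (min_le_right _ _))
  exact M n B

theorem posSet_of_monotone {ι : Type} [Countable ι] {f : (ι → Bool) → Bool} (hm : Monotone f)
    (hb : MeasurableSet {x | f x = true}) : PosSet {x | f x = true} := by
  have : PolishSpace Bool :=
    (Topology.IsClosedEmbedding.of_continuous_injective_isClosedMap
      (f := fun b : Bool => if b then (1 : ℕ) else 0) continuous_of_discreteTopology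
      (by intro a b; cases a <;> cases b <;> simp)
      (fun s _ => isClosed_discrete _)).polishSpace
  have h1 := hb.analyticSet
  have h2 := hb.compl.analyticSet
  rw [MeasureTheory.AnalyticSet] at h1 h2
  rcases h1 with h1 | ⟨p, hp, h1⟩
  · rw [h1]; exact PosSet.empty
  rcases h2 with h2 | ⟨q, hq, h2⟩
  · rw [compl_empty_iff] at h2
    rw [h2]; exact PosSet.univ
  obtain ⟨u, hu1, hu2, hu⟩ := posSeparable_range hp hq (by
    intro a b hab
    have ha : p a ∈ {x | f x = true} := h1 ▸ mem_range_self a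
    have hb : q b ∈ {x | f x = true}ᶜ := h2 ▸ mem_range_self b
    apply hb
    have := hm hab
    simp only [mem_ofPred_eq] at ha ⊢
    rw [ha] at this
    exact top_le_iff.1 this)
  rw [h1] at hu1
  rw [h2, disjoint_compl_left_iff_subset] at hu2
  rwa [hu1.antisymm hu2]

end Separation

/-! ### Basic facts -/

instance idxCountable (a : Arity) : Countable (Idx a) := by
  cases a with
  | none => exact (inferInstance : Countable ℕ)
  | some n => exact (inferInstance : Countable (Fin (n : ℕ)))

theorem vanish_iff {f : BFun} : VanishNearBot f ↔
    ∃ s : Finset (Idx f.1), ∀ x, (∀ i ∈ s, x i = false) → f.2 x = false := by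
  unfold VanishNearBot
  rw [mem_closure_iff]
  push Not
  constructor
  · rintro ⟨o, ho, h0, he⟩
    obtain ⟨I, u, hu, hs⟩ := isOpen_pi_iff.1 ho _ h0
    refine ⟨I, fun x hx => ?_⟩
    by_contra hne
    have hxo : x ∈ o := hs (fun i hi => by rw [hx i hi]; exact (hu i hi).2)
    have : x ∈ o ∩ {x | f.2 x = true} := ⟨hxo, by simpa using hne⟩
    rw [he] at this
    exact this
  · rintro ⟨s, hs⟩
    refine ⟨(s : Set (Idx f.1)).pi (fun _ => {false}),
      isOpen_set_pi s.finite_toSet (fun _ _ => isOpen_discrete _), ?_, ?_⟩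
    · intro i _; simp
    · ext x
      simp only [Set.mem_inter_iff, Set.mem_pi, Set.mem_ofPred_eq, Set.mem_empty_iff_false,
        iff_false, not_and, Set.mem_singleton_iff, Finset.mem_coe]
      intro hx
      simp [hs x hx]

theorem one_iff {f : BFun} : OneNearTop f ↔
    ∃ s : Finset (Idx f.1), ∀ x, (∀ i ∈ s, x i = true) → f.2 x = true := by
  unfold OneNearTop
  rw [mem_closure_iff]
  push Not
  constructor
  · rintro ⟨o, ho, h0, he⟩
    obtain ⟨I, u, hu, hs⟩ := isOpen_pi_iff.1 ho _ h0
    refine ⟨I, fun x hx => ?_⟩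
    by_contra hne
    have hxo : x ∈ o := hs (fun i hi => by rw [hx i hi]; exact (hu i hi).2)
    have : x ∈ o ∩ {x | f.2 x = false} := ⟨hxo, by simpa using hne⟩
    rw [he] at this
    exact this
  · rintro ⟨s, hs⟩
    refine ⟨(s : Set (Idx f.1)).pi (fun _ => {true}),
      isOpen_set_pi s.finite_toSet (fun _ _ => isOpen_discrete _), ?_, ?_⟩
    · intro i _; simp
    · ext x
      simp only [Set.mem_inter_iff, Set.mem_pi, Set.mem_ofPred_eq, Set.mem_empty_iff_false,
        iff_false, not_and, Set.mem_singleton_iff, Finset.mem_coe]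
      intro hx
      simp [hs x hx]

theorem borel_iff {f : BFun} : IsBorelFun f ↔ Measurable f.2 := by
  constructor
  · intro h; exact measurable_to_bool h
  · intro h; exact h (measurableSet_singleton true)

theorem mono_true {α : Type*} [Preorder α] {f : α → Bool} (h : Monotone f) {x y : α} (hxy : x ≤ y)
    (hx : f x = true) : f y = true := by
  have := h hxy
  rw [hx] at this
  exact top_le_iff.1 this

theorem mono_false {α : Type*} [Preorder α] {f : α → Bool} (h : Monotone f) {x y : α} (hxy : x ≤ y)
    (hx : f y = false) : f x = false := by
  have := h hxy
  rw [hx] at this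
  exact le_bot_iff.1 this

theorem mono_of_true {α : Type*} [Preorder α] {f : α → Bool}
    (h : ∀ x y, x ≤ y → f x = true → f y = true) : Monotone f := by
  intro x y hxy
  have := h x y hxy
  revert this
  cases f x <;> cases f y <;> simp

/-- Only one direction of increasing-continuity is nontrivial. -/
theorem incr_iff {f : BFun} (hm : Monotone f.2) : IncrCont f ↔
    ∀ x : ℕ → Idx f.1 → Bool, Monotone x →
      f.2 (fun i => decide (∃ q, x q i = true)) = true → ∃ q, f.2 (x q) = true := by
  constructor
  · rintro ⟨_, h⟩ x hx h1
    rw [h x hx] at h1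
    simpa using h1
  · intro h
    refine ⟨hm, fun x hx => ?_⟩
    rw [Bool.eq_iff_iff, decide_eq_true_iff]
    refine ⟨h x hx, ?_⟩
    rintro ⟨q, hq⟩
    refine mono_true hm (fun i => ?_) hq
    intro hi
    simp only [decide_eq_true_iff]
    exact ⟨q, hi⟩

theorem decr_iff {f : BFun} (hm : Monotone f.2) : DecrCont f ↔
    ∀ x : ℕ → Idx f.1 → Bool, Antitone x →
      f.2 (fun i => decide (∀ q, x q i = true)) = false → ∃ q, f.2 (x q) = false := by
  constructor
  · rintro ⟨_, h⟩ x hx h1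
    rw [h x hx] at h1
    simpa using h1
  · intro h
    refine ⟨hm, fun x hx => ?_⟩
    rw [Bool.eq_iff_iff, decide_eq_true_iff]
    constructor
    · intro h1 q
      refine mono_true hm (fun i => ?_) h1
      intro hi
      simp only [decide_eq_true_iff] at hi
      exact hi q
    · intro h1
      by_contra h2
      obtain ⟨q, hq⟩ := h x hx (by simpa using h2)
      simp [h1 q] at hq

theorem incr_of_cont {f : BFun} (hm : Monotone f.2) (hc : IsContFun f) : IncrCont f := by
  rw [incr_iff hm]
  intro x hx h1
  have ht : Filter.Tendsto x Filter.atTop (nhds (fun i => decide (∃ q, x q i = true))) := by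
    rw [tendsto_pi_nhds]
    intro i
    rw [nhds_discrete, Filter.tendsto_pure]
    by_cases h : ∃ q, x q i = true
    · obtain ⟨q, hq⟩ := h
      filter_upwards [Filter.eventually_ge_atTop q] with r hr
      rw [show x r i = true from hx hr i hq]
      symm
      simpa using ⟨q, hq⟩
    · refine Filter.Eventually.of_forall fun r => ?_
      have h' := h
      simp only [not_exists, Bool.not_eq_true] at h'
      rw [h' r]; symm; simpa using h'
  have := (Continuous.tendsto hc _).comp ht
  rw [nhds_discrete, Filter.tendsto_pure] at this
  obtain ⟨q, hq⟩ := this.exists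
  exact ⟨q, by rw [← h1]; exact hq⟩

theorem decr_of_cont {f : BFun} (hm : Monotone f.2) (hc : IsContFun f) : DecrCont f := by
  rw [decr_iff hm]
  intro x hx h1
  have ht : Filter.Tendsto x Filter.atTop (nhds (fun i => decide (∀ q, x q i = true))) := by
    rw [tendsto_pi_nhds]
    intro i
    rw [nhds_discrete, Filter.tendsto_pure]
    by_cases h : ∃ q, x q i = false
    · obtain ⟨q, hq⟩ := h
      filter_upwards [Filter.eventually_ge_atTop q] with r hr
      have h3 : x r i = false := by
        have := hx hr i
        rw [hq] at this
        exact le_bot_iff.1 this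
      rw [h3]
      symm
      simpa using ⟨q, hq⟩
    · refine Filter.Eventually.of_forall fun r => ?_
      have h' := h
      simp only [not_exists, Bool.not_eq_false] at h'
      rw [h' r]; symm; simpa using h'
  have := (Continuous.tendsto hc _).comp ht
  rw [nhds_discrete, Filter.tendsto_pure] at this
  obtain ⟨q, hq⟩ := this.exists
  exact ⟨q, by rw [← h1]; exact hq⟩

/-- An increasing-continuous function with value `1` takes value `1` at a finite restriction. -/
theorem incr_finset {f : BFun} (h : IncrCont f) {x : Idx f.1 → Bool} (hx : f.2 x = true) :
    ∃ s : Finset (Idx f.1), (∀ i ∈ s, x i = true) ∧ f.2 (fun i => decide (i ∈ s)) = true := by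
  have := Encodable.ofCountable (Idx f.1)
  obtain ⟨q, hq⟩ := (incr_iff h.1).1 h
    (fun q i => decide (Encodable.encode i < q ∧ x i = true)) (by
      intro q r hqr i hi
      simp only [decide_eq_true_iff] at hi ⊢
      exact ⟨hi.1.trans_le hqr, hi.2⟩) (by
      refine Eq.trans (congrArg f.2 (funext fun i => ?_)) hx
      rw [Bool.eq_iff_iff]
      simp only [decide_eq_true_iff]
      exact ⟨fun ⟨_, h⟩ => h.2, fun h => ⟨Encodable.encode i + 1, Nat.lt_succ_self _, h⟩⟩)
  have hfin : {i : Idx f.1 | Encodable.encode i < q ∧ x i = true}.Finite := by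
    refine Set.Finite.subset ((Set.finite_lt_nat q).preimage
      (Encodable.encode_injective.injOn (s := _))) ?_
    intro i hi
    exact hi.1
  refine ⟨hfin.toFinset, ?_, ?_⟩
  · intro i hi
    exact ((hfin.mem_toFinset).1 hi).2
  · refine Eq.trans (congrArg f.2 (funext fun i => ?_)) hq
    rw [Bool.eq_iff_iff]
    simp only [decide_eq_true_iff, hfin.mem_toFinset, Set.mem_ofPred_eq]

theorem decr_finset {f : BFun} (h : DecrCont f) {x : Idx f.1 → Bool} (hx : f.2 x = false) :
    ∃ s : Finset (Idx f.1), (∀ i ∈ s, x i = false) ∧ f.2 (fun i => decide (i ∉ s)) = false := by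
  have := Encodable.ofCountable (Idx f.1)
  obtain ⟨q, hq⟩ := (decr_iff h.1).1 h
    (fun q i => decide (¬ (Encodable.encode i < q ∧ x i = false))) (by
      intro q r hqr i hi
      simp only [decide_eq_true_iff] at hi ⊢
      exact fun h => hi ⟨h.1.trans_le hqr, h.2⟩) (by
      refine Eq.trans (congrArg f.2 (funext fun i => ?_)) hx
      rw [Bool.eq_iff_iff]
      simp only [decide_eq_true_iff]
      constructor
      · intro h
        have := h (Encodable.encode i + 1)
        simpa using this
      · intro h q h'
        simp [h] at h')
  have hfin : {i : Idx f.1 | Encodable.encode i < q ∧ x i = false}.Finite := by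
    refine Set.Finite.subset ((Set.finite_lt_nat q).preimage
      (Encodable.encode_injective.injOn (s := _))) ?_
    intro i hi
    exact hi.1
  refine ⟨hfin.toFinset, ?_, ?_⟩
  · intro i hi
    exact ((hfin.mem_toFinset).1 hi).2
  · refine Eq.trans (congrArg f.2 (funext fun i => ?_)) hq
    rw [Bool.eq_iff_iff]
    simp only [decide_eq_true_iff, hfin.mem_toFinset, Set.mem_ofPred_eq]

theorem one_of_incr {f : BFun} (h : IncrCont f) (ht : PresTop f) : OneNearTop f := by
  rw [one_iff]
  obtain ⟨s, -, hs⟩ := incr_finset h ht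
  refine ⟨s, fun x hx => mono_true h.1 (fun i hi => ?_) hs⟩
  exact hx i (by simpa using hi)

theorem vanish_of_decr {f : BFun} (h : DecrCont f) (ht : PresBot f) : VanishNearBot f := by
  rw [vanish_iff]
  obtain ⟨s, -, hs⟩ := decr_finset h ht
  refine ⟨s, fun x hx => mono_false h.1 (fun i hi => ?_) hs⟩
  simp only [decide_eq_true_iff]
  intro his
  simp [hx i his] at hi

theorem cont_of_incr_decr {f : BFun} (h : IncrCont f) (h' : DecrCont f) : IsContFun f := by
  unfold IsContFun
  rw [continuous_discrete_rng]
  have key1 : IsOpen (f.2 ⁻¹' {true}) := by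
    rw [isOpen_pi_iff]
    intro x hx
    obtain ⟨s, hs1, hs2⟩ := incr_finset h (x := x) hx
    refine ⟨s, fun _ => {true}, fun i hi => ⟨isOpen_discrete _, hs1 i hi⟩, fun y hy => ?_⟩
    refine mono_true h.1 (fun i hi => ?_) hs2
    exact hy i (by simpa using hi)
  have key2 : IsOpen (f.2 ⁻¹' {false}) := by
    rw [isOpen_pi_iff]
    intro x hx
    obtain ⟨s, hs1, hs2⟩ := decr_finset h' (x := x) hx
    refine ⟨s, fun _ => {false}, fun i hi => ⟨isOpen_discrete _, hs1 i hi⟩, fun y hy => ?_⟩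
    refine mono_false h.1 (fun i hi => ?_) hs2
    simp only [decide_eq_true_iff]
    intro his
    have : y i = false := hy i his
    simp [this] at hi
  intro b
  cases b
  · exact key2
  · exact key1

/-! ### Clones -/

theorem IsClone.inter {F G : Set BFun} (hF : IsClone F) (hG : IsClone G) : IsClone (F ∩ G) where
  proj a i := ⟨hF.proj a i, hG.proj a i⟩
  comp a b g f hg hf := ⟨hF.comp a b g f hg.1 fun i => (hf i).1, hG.comp a b g f hg.2 fun i => (hf i).2⟩

theorem clone_base : IsClone Base where
  proj a i := by
    refine ⟨borel_iff.2 (measurable_pi_apply i), fun x y h => h i, rfl, rfl⟩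
  comp a b g f hg hf := by
    refine ⟨borel_iff.2 ?_, ?_, ?_, ?_⟩
    · exact (borel_iff.1 hg.1).comp (measurable_pi_iff.2 fun i => borel_iff.1 (hf i).1)
    · exact fun x y h => hg.2.1 fun i => (hf i).2.1 h
    · have h1 : ∀ i, f i (fun _ => false) = false := fun i => (hf i).2.2.1
      have h2 : g (fun _ => false) = false := hg.2.2.1
      simp [PresBot, h1, h2]
    · have h1 : ∀ i, f i (fun _ => true) = true := fun i => (hf i).2.2.2
      have h2 : g (fun _ => true) = true := hg.2.2.2
      simp [PresTop, h1, h2]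

theorem clone_vanish : IsClone {f | VanishNearBot f} where
  proj a i := by
    rw [Set.mem_ofPred_eq, vanish_iff]
    exact ⟨{i}, fun x hx => hx i (by simp)⟩
  comp a b g f hg hf := by
    simp only [Set.mem_ofPred_eq, vanish_iff] at hg hf ⊢
    obtain ⟨s, hs⟩ := hg
    choose t ht using hf
    refine ⟨s.biUnion t, fun x hx => hs _ fun i hi => ht i x fun j hj => hx j ?_⟩
    exact Finset.mem_biUnion.2 ⟨i, hi, hj⟩

theorem clone_one : IsClone {f | OneNearTop f} where
  proj a i := by
    rw [Set.mem_ofPred_eq, one_iff]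
    exact ⟨{i}, fun x hx => hx i (by simp)⟩
  comp a b g f hg hf := by
    simp only [Set.mem_ofPred_eq, one_iff] at hg hf ⊢
    obtain ⟨s, hs⟩ := hg
    choose t ht using hf
    refine ⟨s.biUnion t, fun x hx => hs _ fun i hi => ht i x fun j hj => hx j ?_⟩
    exact Finset.mem_biUnion.2 ⟨i, hi, hj⟩

theorem clone_incr : IsClone {f | IncrCont f} where
  proj a i := ⟨fun x y h => h i, fun x _ => rfl⟩
  comp a b g f hg hf := by
    refine ⟨fun x y h => hg.1 fun i => (hf i).1 h, fun x hx => ?_⟩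
    have h1 : ∀ i, f i (fun j => decide (∃ q, x q j = true)) = decide (∃ q, f i (x q) = true) :=
      fun i => (hf i).2 x hx
    simp only [h1]
    exact hg.2 (fun q i => f i (x q)) fun q r hqr i => (hf i).1 (hx hqr)

theorem clone_decr : IsClone {f | DecrCont f} where
  proj a i := ⟨fun x y h => h i, fun x _ => rfl⟩
  comp a b g f hg hf := by
    refine ⟨fun x y h => hg.1 fun i => (hf i).1 h, fun x hx => ?_⟩
    have h1 : ∀ i, f i (fun j => decide (∀ q, x q j = true)) = decide (∀ q, f i (x q) = true) :=
      fun i => (hf i).2 x hx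
    simp only [h1]
    exact hg.2 (fun q i => f i (x q)) fun q r hqr i => (hf i).1 (hx hqr)

theorem clone_cont : IsClone {f | IsContFun f} where
  proj a i := by
    have hc : Continuous (fun z : Idx a → Bool => z i) := continuous_apply i
    exact hc
  comp a b g f hg hf := Continuous.comp (g := g) hg (continuous_pi fun i => hf i)

theorem finite_facts {f : BFun} (hf : finitary f) : IsBorelFun f ∧ IsContFun f := by
  obtain ⟨a, f⟩ := f
  cases a with
  | none => exact absurd rfl hf
  | some n =>
    constructor
    · exact (Set.toFinite (α := Fin n → Bool) _).measurableSet
    · exact continuous_of_discreteTopology (α := Fin n → Bool)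

theorem finRes_of {Q : BFun → Prop} (h : ∀ f, f ∈ Base → IsContFun f → Q f) :
    finRes {f ∈ Base | Q f} = {f | finitary f ∧ Monotone f.2 ∧ PresBot f ∧ PresTop f} := by
  ext f
  constructor
  · rintro ⟨⟨h1, -⟩, h2⟩
    exact ⟨h2, h1.2⟩
  · rintro ⟨h1, h2⟩
    have h3 := finite_facts h1
    exact ⟨⟨⟨h3.1, h2⟩, h _ ⟨h3.1, h2⟩ h3.2⟩, h1⟩

theorem part_one : ∀ C ∈ [P1, P2, P3, P4, P5, P6, P7, P8, P9], IsClone C ∧ C ⊆ BorelClass ∧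
      finRes C = {f | finitary f ∧ Monotone f.2 ∧ PresBot f ∧ PresTop f} := by
  have hI : ∀ f, f ∈ Base → IsContFun f → IncrCont f := fun f hf hc => incr_of_cont hf.2.1 hc
  have hD : ∀ f, f ∈ Base → IsContFun f → DecrCont f := fun f hf hc => decr_of_cont hf.2.1 hc
  have hO : ∀ f, f ∈ Base → IsContFun f → OneNearTop f :=
    fun f hf hc => one_of_incr (hI f hf hc) hf.2.2.2
  have hV : ∀ f, f ∈ Base → IsContFun f → VanishNearBot f :=
    fun f hf hc => vanish_of_decr (hD f hf hc) hf.2.2.1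
  simp only [List.forall_mem_cons, List.not_mem_nil, false_imp_iff, implies_true, and_true]
  refine ⟨?_, ?_, ?_, ?_, ?_, ?_, ?_, ?_, ?_⟩
  · refine ⟨clone_base, fun f hf => hf.1, ?_⟩
    have := finRes_of (Q := fun _ => True) (fun _ _ _ => trivial)
    simpa [P1] using this
  · exact ⟨clone_base.inter clone_one, fun f hf => hf.1.1, finRes_of hO⟩
  · exact ⟨clone_base.inter clone_incr, fun f hf => hf.1.1, finRes_of hI⟩
  · exact ⟨clone_base.inter clone_vanish, fun f hf => hf.1.1, finRes_of hV⟩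
  · exact ⟨clone_base.inter clone_decr, fun f hf => hf.1.1, finRes_of hD⟩
  · exact ⟨clone_base.inter (clone_vanish.inter clone_one), fun f hf => hf.1.1,
      finRes_of fun f h h' => ⟨hV f h h', hO f h h'⟩⟩
  · exact ⟨clone_base.inter (clone_incr.inter clone_vanish), fun f hf => hf.1.1,
      finRes_of fun f h h' => ⟨hI f h h', hV f h h'⟩⟩
  · exact ⟨clone_base.inter (clone_decr.inter clone_one), fun f hf => hf.1.1,
      finRes_of fun f h h' => ⟨hD f h h', hO f h h'⟩⟩
  · exact ⟨clone_base.inter clone_cont, fun f hf => hf.1.1, finRes_of fun f h h' => h'⟩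

/-! ### Clones over the finitary monotone functions -/

/-- `F` is a clone with the prescribed finitary restriction. -/
structure Over (F : Set BFun) : Prop where
  clone : IsClone F
  borel : F ⊆ BorelClass
  fin : finRes F = {f | finitary f ∧ Monotone f.2 ∧ PresBot f ∧ PresTop f}

/-- `F` is closed under countable disjunctions. -/
def HasOr (F : Set BFun) : Prop := ∀ (b : Arity) (φ : ℕ → (Idx b → Bool) → Bool),
  (∀ n, (⟨b, φ n⟩ : BFun) ∈ F) → (⟨b, fun x => decide (∃ n, φ n x = true)⟩ : BFun) ∈ F

/-- `F` is closed under countable conjunctions. -/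
def HasAnd (F : Set BFun) : Prop := ∀ (b : Arity) (φ : ℕ → (Idx b → Bool) → Bool),
  (∀ n, (⟨b, φ n⟩ : BFun) ∈ F) → (⟨b, fun x => decide (∀ n, φ n x = true)⟩ : BFun) ∈ F

/-- `F` is closed under `v ∧ ⋁ φ`. -/
def HasAndOr (F : Set BFun) : Prop :=
  ∀ (b : Arity) (v : (Idx b → Bool) → Bool) (φ : ℕ → (Idx b → Bool) → Bool), (⟨b, v⟩ : BFun) ∈ F →
  (∀ n, (⟨b, φ n⟩ : BFun) ∈ F) → (⟨b, fun x => v x && decide (∃ n, φ n x = true)⟩ : BFun) ∈ F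

/-- `F` is closed under `u ∨ ⋀ φ`. -/
def HasOrAnd (F : Set BFun) : Prop :=
  ∀ (b : Arity) (u : (Idx b → Bool) → Bool) (φ : ℕ → (Idx b → Bool) → Bool), (⟨b, u⟩ : BFun) ∈ F →
  (∀ n, (⟨b, φ n⟩ : BFun) ∈ F) → (⟨b, fun x => u x || decide (∀ n, φ n x = true)⟩ : BFun) ∈ F

namespace Over

variable {F : Set BFun}

theorem fin_mem (h : Over F) (n : ℕ+) (f : (Fin n → Bool) → Bool) (hm : Monotone f)
    (h0 : f (fun _ => false) = false) (h1 : f (fun _ => true) = true) :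
    (⟨some n, f⟩ : BFun) ∈ F := by
  have : (⟨some n, f⟩ : BFun) ∈ finRes F := by
    rw [h.fin]
    exact ⟨by simp [finitary], hm, h0, h1⟩
  exact this.1

theorem fin_props (h : Over F) {n : ℕ+} {f : (Fin n → Bool) → Bool} (hf : (⟨some n, f⟩ : BFun) ∈ F) :
    Monotone f ∧ f (fun _ => false) = false ∧ f (fun _ => true) = true := by
  have : (⟨some n, f⟩ : BFun) ∈ finRes F := ⟨hf, by simp [finitary]⟩
  rw [h.fin] at this
  exact this.2

theorem or_mem (h : Over F) {b : Arity} {f g : (Idx b → Bool) → Bool} (hf : (⟨b, f⟩ : BFun) ∈ F)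
    (hg : (⟨b, g⟩ : BFun) ∈ F) : (⟨b, fun x => f x || g x⟩ : BFun) ∈ F := by
  have h2 : (⟨some ⟨2, by norm_num⟩, fun z : Fin 2 → Bool => z 0 || z 1⟩ : BFun) ∈ F := by
    refine h.fin_mem ⟨2, by norm_num⟩ _ ?_ rfl rfl
    refine mono_of_true fun x y hxy hx => ?_
    simp only [Bool.or_eq_true] at hx ⊢
    exact hx.imp (fun hx => hxy (0 : Fin 2) hx) (fun hx => hxy (1 : Fin 2) hx)
  exact h.clone.comp (some ⟨2, by norm_num⟩) b _ (fun i : Fin 2 => if i = 0 then f else g) h2 (by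
    intro (i : Fin 2)
    by_cases hi : i = 0
    · simpa [hi] using hf
    · simpa [hi] using hg)

theorem and_mem (h : Over F) {b : Arity} {f g : (Idx b → Bool) → Bool} (hf : (⟨b, f⟩ : BFun) ∈ F)
    (hg : (⟨b, g⟩ : BFun) ∈ F) : (⟨b, fun x => f x && g x⟩ : BFun) ∈ F := by
  have h2 : (⟨some ⟨2, by norm_num⟩, fun z : Fin 2 → Bool => z 0 && z 1⟩ : BFun) ∈ F := by
    refine h.fin_mem ⟨2, by norm_num⟩ _ ?_ rfl rfl
    refine mono_of_true fun x y hxy hx => ?_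
    simp only [Bool.and_eq_true] at hx ⊢
    exact hx.imp (fun hx => hxy (0 : Fin 2) hx) (fun hx => hxy (1 : Fin 2) hx)
  exact h.clone.comp (some ⟨2, by norm_num⟩) b _ (fun i : Fin 2 => if i = 0 then f else g) h2 (by
    intro (i : Fin 2)
    by_cases hi : i = 0
    · simpa [hi] using hf
    · simpa [hi] using hg)

theorem finset_and (h : Over F) {b : Arity} {ι : Type} {φ : ι → (Idx b → Bool) → Bool}
    (hφ : ∀ i, (⟨b, φ i⟩ : BFun) ∈ F) {s : Finset ι} (hs : s.Nonempty) :
    (⟨b, fun x => decide (∀ i ∈ s, φ i x = true)⟩ : BFun) ∈ F := by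
  induction hs using Finset.Nonempty.cons_induction with
  | singleton a =>
    convert hφ a using 2
    funext x; simp
  | cons a s ha hs ih =>
    convert h.and_mem (hφ a) ih using 2
    funext x
    rw [Bool.eq_iff_iff]
    simp

theorem finset_or (h : Over F) {b : Arity} {ι : Type} {φ : ι → (Idx b → Bool) → Bool}
    (hφ : ∀ i, (⟨b, φ i⟩ : BFun) ∈ F) {s : Finset ι} (hs : s.Nonempty) :
    (⟨b, fun x => decide (∃ i ∈ s, φ i x = true)⟩ : BFun) ∈ F := by
  induction hs using Finset.Nonempty.cons_induction with
  | singleton a =>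
    convert hφ a using 2
    funext x; simp
  | cons a s ha hs ih =>
    convert h.or_mem (hφ a) ih using 2
    funext x
    rw [Bool.eq_iff_iff]
    simp

theorem subset_base (h : Over F) : F ⊆ Base := by
  rintro ⟨a, f⟩ hf
  refine ⟨h.borel hf, ?_, ?_, ?_⟩
  · intro x y hxy
    let c : Idx a → Fin 3 := fun i => if x i then 2 else if y i then 1 else 0
    have hg : (⟨some ⟨3, by norm_num⟩, fun z : Fin 3 → Bool => f fun i => z (c i)⟩ : BFun) ∈ F :=
      h.clone.comp a (some ⟨3, by norm_num⟩) f (fun i (z : Fin 3 → Bool) => z (c i)) hf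
        (fun i => h.clone.proj (some ⟨3, by norm_num⟩) (c i))
    have hm := (h.fin_props hg).1
    have h1 : (![false, false, true] : Fin 3 → Bool) ≤ ![false, true, true] := by
      intro i; fin_cases i <;> simp
    have h2 := hm h1
    have hx : (fun i => (![false, false, true] : Fin 3 → Bool) (c i)) = x := by
      funext i
      cases hxi : x i <;> cases hyi : y i <;> simp [c, hxi, hyi]
    have hy : (fun i => (![false, true, true] : Fin 3 → Bool) (c i)) = y := by
      funext i
      have := hxy i
      cases hxi : x i <;> cases hyi : y i <;> simp [c, hxi, hyi]
      rw [hxi, hyi] at this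
      exact absurd (this rfl) (by simp)
    have e1 : f (fun i => (![false, false, true] : Fin 3 → Bool) (c i)) ≤
      f (fun i => (![false, true, true] : Fin 3 → Bool) (c i)) := h2
    rw [hx, hy] at e1
    exact e1
  · have hg : (⟨some 1, fun z : Fin 1 → Bool => f fun _ => z 0⟩ : BFun) ∈ F :=
      h.clone.comp a (some 1) f (fun i (z : Fin 1 → Bool) => z 0) hf
        (fun i => h.clone.proj (some 1) (0 : Fin 1))
    exact (h.fin_props hg).2.1
  · have hg : (⟨some 1, fun z : Fin 1 → Bool => f fun _ => z 0⟩ : BFun) ∈ F :=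
      h.clone.comp a (some 1) f (fun i (z : Fin 1 → Bool) => z 0) hf
        (fun i => h.clone.proj (some 1) (0 : Fin 1))
    exact (h.fin_props hg).2.2

/-- A function that is not increasing-continuous yields `u ∨ ⋀ φ`. -/
theorem hasOrAnd (h : Over F) {f : BFun} (hf : f ∈ F) (hn : ¬ IncrCont f) : HasOrAnd F := by
  intro b u φ hu hφ
  obtain ⟨hB, hm, h0, h1⟩ := h.subset_base hf
  rw [incr_iff hm] at hn
  push Not at hn
  obtain ⟨x, hx, hx1, hx0⟩ := hn
  let c : Idx f.1 → (Idx b → Bool) → Bool := fun i =>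
    if hi : ∃ q, x q i = true then
      fun z => decide (∀ k ∈ Finset.range (Nat.find hi + 1), φ k z = true) else u
  have hc : ∀ i, (⟨b, c i⟩ : BFun) ∈ F := by
    intro i
    by_cases hi : ∃ q, x q i = true
    · have := h.finset_and hφ (s := Finset.range (Nat.find hi + 1)) (by simp)
      simp only [c, dif_pos hi]
      convert this
    · simpa only [c, dif_neg hi] using hu
  have hmem := h.or_mem hu (h.clone.comp f.1 b f.2 c hf hc)
  convert hmem using 2
  funext z
  cases huz : u z with
  | true => simp
  | false =>
    simp only [Bool.false_or]
    by_cases hall : ∀ n, φ n z = true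
    · rw [decide_eq_true hall]
      symm
      refine mono_true hm (fun i hi => ?_) hx1
      simp only [decide_eq_true_iff] at hi
      simp only [c, dif_pos hi, decide_eq_true_iff]
      exact fun k _ => hall k
    · rw [decide_eq_false hall]
      symm
      push Not at hall
      obtain ⟨k, hk⟩ := hall
      have := hx0 k
      refine mono_false hm (fun i hi => ?_) (by simpa using this)
      by_cases hi' : ∃ q, x q i = true
      · simp only [c, dif_pos hi', decide_eq_true_iff] at hi
        have hlt : Nat.find hi' < k := by
          by_contra hlt
          exact hk (hi k (Finset.mem_range.2 (by omega)))
        exact hx hlt.le i (Nat.find_spec hi')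
      · simp only [c, dif_neg hi', huz] at hi
        exact absurd hi (by simp)

/-- A function that is not decreasing-continuous yields `v ∧ ⋁ φ`. -/
theorem hasAndOr (h : Over F) {f : BFun} (hf : f ∈ F) (hn : ¬ DecrCont f) : HasAndOr F := by
  intro b u φ hu hφ
  obtain ⟨hB, hm, h0, h1⟩ := h.subset_base hf
  rw [decr_iff hm] at hn
  push Not at hn
  obtain ⟨x, hx, hx1, hx0⟩ := hn
  let c : Idx f.1 → (Idx b → Bool) → Bool := fun i =>
    if hi : ∃ q, x q i = false then
      fun z => decide (∃ k ∈ Finset.range (Nat.find hi + 1), φ k z = true) else u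
  have hc : ∀ i, (⟨b, c i⟩ : BFun) ∈ F := by
    intro i
    by_cases hi : ∃ q, x q i = false
    · have := h.finset_or hφ (s := Finset.range (Nat.find hi + 1)) (by simp)
      simp only [c, dif_pos hi]
      convert this
    · simpa only [c, dif_neg hi] using hu
  have hmem := h.and_mem hu (h.clone.comp f.1 b f.2 c hf hc)
  convert hmem using 2
  funext z
  cases huz : u z with
  | false => simp
  | true =>
    simp only [Bool.true_and]
    by_cases hall : ∃ n, φ n z = true
    · rw [decide_eq_true hall]
      symm
      obtain ⟨k, hk⟩ := hall
      have := hx0 k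
      refine mono_true hm (fun i hi => ?_) (by simpa using this)
      by_cases hi' : ∃ q, x q i = false
      · simp only [c, dif_pos hi', decide_eq_true_iff]
        refine ⟨k, ?_, hk⟩
        rw [Finset.mem_range]
        by_contra hlt
        have h5 := hx (show Nat.find hi' ≤ k by omega) i hi
        rw [Nat.find_spec hi'] at h5
        simp at h5
      · simp only [c, dif_neg hi', huz]
    · rw [decide_eq_false hall]
      symm
      push Not at hall
      refine mono_false hm (fun i hi => ?_) hx1
      simp only [decide_eq_true_iff]
      intro q
      by_contra hq
      have hi' : ∃ q, x q i = false := ⟨q, by simpa using hq⟩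
      simp only [c, dif_pos hi', decide_eq_true_iff] at hi
      obtain ⟨k, -, hk⟩ := hi
      exact hall k hk

theorem hasOr (h : Over F) {f : BFun} (hf : f ∈ F) (hn : ¬ VanishNearBot f) : HasOr F := by
  intro b φ hφ
  obtain ⟨hB, hm, h0, h1⟩ := h.subset_base hf
  rw [vanish_iff] at hn
  push Not at hn
  have := Encodable.ofCountable (Idx f.1)
  have hmem := h.clone.comp f.1 b f.2
    (fun i z => decide (∃ k ∈ Finset.range (Encodable.encode i + 1), φ k z = true)) hf
    (fun i => by
      convert h.finset_or hφ (s := Finset.range (Encodable.encode i + 1)) (by simp))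
  convert hmem using 2
  funext z
  by_cases hall : ∃ n, φ n z = true
  · rw [decide_eq_true hall]
    symm
    obtain ⟨k, hk⟩ := hall
    have hfin : {i : Idx f.1 | Encodable.encode i < k}.Finite :=
      (Set.finite_lt_nat k).preimage (Encodable.encode_injective.injOn (s := _))
    obtain ⟨x, hx, hx1⟩ := hn hfin.toFinset
    refine mono_true hm (fun i hi => ?_) (by simpa using hx1)
    simp only [decide_eq_true_iff]
    refine ⟨k, ?_, hk⟩
    rw [Finset.mem_range]
    by_contra hlt
    have := hx i (hfin.mem_toFinset.2 (show Encodable.encode i < k by omega))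
    simp [this] at hi
  · rw [decide_eq_false hall]
    symm
    push Not at hall
    refine mono_false hm (fun i hi => ?_) h0
    simp only [decide_eq_true_iff] at hi
    obtain ⟨k, -, hk⟩ := hi
    exact absurd hk (hall k)

theorem hasAnd (h : Over F) {f : BFun} (hf : f ∈ F) (hn : ¬ OneNearTop f) : HasAnd F := by
  intro b φ hφ
  obtain ⟨hB, hm, h0, h1⟩ := h.subset_base hf
  rw [one_iff] at hn
  push Not at hn
  have := Encodable.ofCountable (Idx f.1)
  have hmem := h.clone.comp f.1 b f.2
    (fun i z => decide (∀ k ∈ Finset.range (Encodable.encode i + 1), φ k z = true)) hf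
    (fun i => by
      convert h.finset_and hφ (s := Finset.range (Encodable.encode i + 1)) (by simp))
  convert hmem using 2
  funext z
  by_cases hall : ∀ n, φ n z = true
  · rw [decide_eq_true hall]
    symm
    refine mono_true hm (fun i hi => ?_) h1
    simp only [decide_eq_true_iff]
    exact fun k _ => hall k
  · rw [decide_eq_false hall]
    symm
    push Not at hall
    obtain ⟨k, hk⟩ := hall
    have hfin : {i : Idx f.1 | Encodable.encode i < k}.Finite :=
      (Set.finite_lt_nat k).preimage (Encodable.encode_injective.injOn (s := _))
    obtain ⟨x, hx, hx1⟩ := hn hfin.toFinset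
    refine mono_false hm (fun i hi => ?_) (by simpa using hx1)
    simp only [decide_eq_true_iff] at hi
    refine hx i (hfin.mem_toFinset.2 (show Encodable.encode i < k from ?_))
    by_contra hlt
    exact hk (hi k (Finset.mem_range.2 (by omega)))

/-- An upper bound in `F` for a function vanishing near `0⃗`. -/
theorem upper_of_vanish (h : Over F) {f : BFun} (hB : f ∈ Base) (hv : VanishNearBot f) :
    ∃ v : (Idx f.1 → Bool) → Bool, (⟨f.1, v⟩ : BFun) ∈ F ∧ ∀ x, f.2 x = true → v x = true := by
  obtain ⟨s, hs⟩ := vanish_iff.1 hv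
  have hne : s.Nonempty := by
    rw [Finset.nonempty_iff_ne_empty]
    rintro rfl
    have := hs (fun _ => true) (by simp)
    have h1 : f.2 (fun _ => true) = true := hB.2.2.2
    simp [h1] at this
  refine ⟨_, h.finset_or (φ := fun i x => x i) (fun i => h.clone.proj f.1 i) hne, ?_⟩
  intro x hx
  rw [decide_eq_true_iff]
  by_contra hcon
  push Not at hcon
  have := hs x (fun i hi => by simpa using hcon i hi)
  simp [hx] at this

/-- A lower bound in `F` for a function equal to `1` near `1⃗`. -/
theorem lower_of_one (h : Over F) {f : BFun} (hB : f ∈ Base) (hv : OneNearTop f) :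
    ∃ u : (Idx f.1 → Bool) → Bool, (⟨f.1, u⟩ : BFun) ∈ F ∧ ∀ x, u x = true → f.2 x = true := by
  obtain ⟨s, hs⟩ := one_iff.1 hv
  have hne : s.Nonempty := by
    rw [Finset.nonempty_iff_ne_empty]
    rintro rfl
    have := hs (fun _ => false) (by simp)
    have h1 : f.2 (fun _ => false) = false := hB.2.2.1
    simp [h1] at this
  refine ⟨_, h.finset_and (φ := fun i x => x i) (fun i => h.clone.proj f.1 i) hne, ?_⟩
  intro x hx
  rw [decide_eq_true_iff] at hx
  exact hs x hx

theorem idx_nonempty (a : Arity) : Nonempty (Idx a) := by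
  cases a with
  | none => exact ⟨(0 : ℕ)⟩
  | some n => exact ⟨(⟨0, n.pos⟩ : Fin n)⟩

theorem upper_of_hasOr (h : Over F) (ho : HasOr F) {f : BFun} (hB : f ∈ Base) :
    ∃ v : (Idx f.1 → Bool) → Bool, (⟨f.1, v⟩ : BFun) ∈ F ∧ ∀ x, f.2 x = true → v x = true := by
  have := idx_nonempty f.1
  obtain ⟨e, he⟩ := exists_surjective_nat (Idx f.1)
  refine ⟨_, ho f.1 (fun n x => x (e n)) (fun n => h.clone.proj f.1 (e n)), ?_⟩
  intro x hx
  rw [decide_eq_true_iff]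
  by_contra hcon
  push Not at hcon
  have hx0 : x = fun _ => false := by
    funext i
    obtain ⟨n, rfl⟩ := he i
    simpa using hcon n
  have h1 : f.2 (fun _ => false) = false := hB.2.2.1
  rw [hx0, h1] at hx
  simp at hx

theorem lower_of_hasAnd (h : Over F) (ho : HasAnd F) {f : BFun} (hB : f ∈ Base) :
    ∃ u : (Idx f.1 → Bool) → Bool, (⟨f.1, u⟩ : BFun) ∈ F ∧ ∀ x, u x = true → f.2 x = true := by
  have := idx_nonempty f.1
  obtain ⟨e, he⟩ := exists_surjective_nat (Idx f.1)
  refine ⟨_, ho f.1 (fun n x => x (e n)) (fun n => h.clone.proj f.1 (e n)), ?_⟩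
  intro x hx
  rw [decide_eq_true_iff] at hx
  have hx0 : x = fun _ => true := by
    funext i
    obtain ⟨n, rfl⟩ := he i
    exact hx n
  rw [hx0]
  exact hB.2.2.2

/-- An increasing-continuous function with an upper bound in `F`. -/
theorem mem_of_incr (h : Over F) (ha : HasAndOr F) {f : BFun} (hB : f ∈ Base) (hi : IncrCont f)
    {v : (Idx f.1 → Bool) → Bool} (hv : (⟨f.1, v⟩ : BFun) ∈ F)
    (hfv : ∀ x, f.2 x = true → v x = true) : f ∈ F := by
  let S := {s : Finset (Idx f.1) // f.2 (fun i => decide (i ∈ s)) = true}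
  have hS : Nonempty S := by
    obtain ⟨s, -, hs⟩ := incr_finset hi (x := fun _ => true) hB.2.2.2
    exact ⟨⟨s, hs⟩⟩
  obtain ⟨e, he⟩ := exists_surjective_nat S
  have hne : ∀ s : S, s.1.Nonempty := by
    rintro ⟨s, hs⟩
    rw [Finset.nonempty_iff_ne_empty]
    rintro rfl
    have h1 : f.2 (fun _ => false) = false := hB.2.2.1
    simp [h1] at hs
  have hmem := ha f.1 v (fun n x => decide (∀ i ∈ (e n).1, x i = true)) hv
    (fun n => h.finset_and (φ := fun i x => x i) (fun i => h.clone.proj f.1 i) (hne (e n)))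
  convert hmem using 1
  refine Sigma.ext rfl (heq_of_eq ?_)
  funext x
  rw [Bool.eq_iff_iff]
  simp only [Bool.and_eq_true, decide_eq_true_iff]
  constructor
  · intro hx
    refine ⟨hfv x hx, ?_⟩
    obtain ⟨s, hs1, hs2⟩ := incr_finset hi hx
    obtain ⟨n, hn⟩ := he ⟨s, hs2⟩
    exact ⟨n, by rw [hn]; exact hs1⟩
  · rintro ⟨-, n, hn⟩
    refine mono_true hi.1 (fun i hi => ?_) (e n).2
    exact hn i (by simpa using hi)

theorem mem_of_decr (h : Over F) (ha : HasOrAnd F) {f : BFun} (hB : f ∈ Base) (hi : DecrCont f)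
    {u : (Idx f.1 → Bool) → Bool} (hu : (⟨f.1, u⟩ : BFun) ∈ F)
    (hfu : ∀ x, u x = true → f.2 x = true) : f ∈ F := by
  let S := {s : Finset (Idx f.1) // f.2 (fun i => decide (i ∉ s)) = false}
  have hS : Nonempty S := by
    obtain ⟨s, -, hs⟩ := decr_finset hi (x := fun _ => false) hB.2.2.1
    exact ⟨⟨s, hs⟩⟩
  obtain ⟨e, he⟩ := exists_surjective_nat S
  have hne : ∀ s : S, s.1.Nonempty := by
    rintro ⟨s, hs⟩
    rw [Finset.nonempty_iff_ne_empty]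
    rintro rfl
    have h1 : f.2 (fun _ => true) = true := hB.2.2.2
    simp [h1] at hs
  have hmem := ha f.1 u (fun n x => decide (∃ i ∈ (e n).1, x i = true)) hu
    (fun n => h.finset_or (φ := fun i x => x i) (fun i => h.clone.proj f.1 i) (hne (e n)))
  convert hmem using 1
  refine Sigma.ext rfl (heq_of_eq ?_)
  funext x
  rw [Bool.eq_iff_iff]
  simp only [Bool.or_eq_true, decide_eq_true_iff]
  constructor
  · intro hx
    right
    intro n
    by_contra hcon
    push Not at hcon
    have : f.2 x = false := by
      refine mono_false hi.1 (fun i hi => ?_) (e n).2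
      simp only [decide_eq_true_iff]
      intro his
      exact hcon i his hi
    simp [hx] at this
  · rintro (hx | hx)
    · exact hfu x hx
    · by_contra hf
      obtain ⟨s, hs1, hs2⟩ := decr_finset hi (x := x) (by simpa using hf)
      obtain ⟨n, hn⟩ := he ⟨s, hs2⟩
      obtain ⟨i, his, hxi⟩ := hx n
      rw [hn] at his
      simp [hs1 i his] at hxi

/-- Interpolation of monotone Borel functions between members of `F`. -/
theorem mem_of_between (h : Over F) (ha : HasAndOr F) (ho : HasOrAnd F) {f : BFun} (hB : f ∈ Base)
    {u v : (Idx f.1 → Bool) → Bool} (hu : (⟨f.1, u⟩ : BFun) ∈ F) (hv : (⟨f.1, v⟩ : BFun) ∈ F)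
    (hfu : ∀ x, u x = true → f.2 x = true) (hfv : ∀ x, f.2 x = true → v x = true) : f ∈ F := by
  have key : ∀ A : Set (Idx f.1 → Bool), PosSet A →
      (⟨f.1, fun x => (u x || decide (x ∈ A)) && v x⟩ : BFun) ∈ F := by
    intro A hA
    induction hA with
    | coord i =>
      convert h.and_mem (h.or_mem hu (h.clone.proj f.1 i)) hv using 2
      funext x
      simp
    | univ =>
      convert hv using 2
      funext x
      simp
    | empty =>
      convert hu using 2
      funext x
      rw [Bool.eq_iff_iff]
      simp
      exact fun hx => hfv x (hfu x hx)
    | iUnion s hs ih =>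
      convert ha f.1 v _ hv ih using 2
      funext x
      rw [Bool.eq_iff_iff]
      simp only [Bool.and_eq_true, Bool.or_eq_true, decide_eq_true_iff, Set.mem_iUnion]
      constructor
      · rintro ⟨hx | ⟨n, hn⟩, hvx⟩
        · exact ⟨hvx, 0, Or.inl hx, hvx⟩
        · exact ⟨hvx, n, Or.inr hn, hvx⟩
      · rintro ⟨hvx, n, hx | hn, -⟩
        · exact ⟨Or.inl hx, hvx⟩
        · exact ⟨Or.inr ⟨n, hn⟩, hvx⟩
    | iInter s hs ih =>
      convert ho f.1 u _ hu ih using 2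
      funext x
      rw [Bool.eq_iff_iff]
      simp only [Bool.and_eq_true, Bool.or_eq_true, decide_eq_true_iff, Set.mem_iInter]
      constructor
      · rintro ⟨hx | hx, hvx⟩
        · exact Or.inl hx
        · exact Or.inr fun n => ⟨Or.inr (hx n), hvx⟩
      · rintro (hx | hx)
        · exact ⟨Or.inl hx, hfv x (hfu x hx)⟩
        · refine ⟨?_, (hx 0).2⟩
          by_cases hux : u x = true
          · exact Or.inl hux
          · exact Or.inr fun n => (hx n).1.resolve_left hux
  convert key _ (posSet_of_monotone hB.2.1 hB.1) using 1
  refine Sigma.ext rfl (heq_of_eq ?_)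
  funext x
  rw [Bool.eq_iff_iff]
  simp only [Bool.and_eq_true, Bool.or_eq_true, decide_eq_true_iff, Set.mem_ofPred_eq]
  exact ⟨fun hx => ⟨Or.inr hx, hfv x hx⟩, fun hx => hx.1.elim (hfu x) id⟩

/-- Continuous members of the base class are finite joins of finite meets. -/
theorem cont_subset (h : Over F) : P9 ⊆ F := by
  rintro f ⟨hB, hc⟩
  have hi := incr_of_cont hB.2.1 hc
  have hcpt : IsCompact (f.2 ⁻¹' {true}) :=
    ((isClosed_discrete ({true} : Set Bool)).preimage hc).isCompact
  let S := {s : Finset (Idx f.1) // f.2 (fun i => decide (i ∈ s)) = true}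
  have hne : ∀ s : S, s.1.Nonempty := by
    rintro ⟨s, hs⟩
    rw [Finset.nonempty_iff_ne_empty]
    rintro rfl
    have h1 : f.2 (fun _ => false) = false := hB.2.2.1
    simp [h1] at hs
  obtain ⟨t, ht⟩ := hcpt.elim_finite_subcover
    (fun s : S => (s.1 : Set (Idx f.1)).pi (fun _ => ({true} : Set Bool)))
    (fun s => isOpen_set_pi s.1.finite_toSet (fun _ _ => isOpen_discrete _)) (by
      intro x hx
      obtain ⟨s, hs1, hs2⟩ := incr_finset hi (x := x) hx
      exact Set.mem_iUnion.2 ⟨⟨s, hs2⟩, fun i hi => hs1 i hi⟩)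
  have htne : t.Nonempty := by
    have : (fun _ => true) ∈ f.2 ⁻¹' {true} := hB.2.2.2
    have := ht this
    simp only [Set.mem_iUnion] at this
    obtain ⟨s, hs, -⟩ := this
    exact ⟨s, hs⟩
  have hmem := h.finset_or (φ := fun (s : S) x => decide (∀ i ∈ s.1, x i = true))
    (fun s => h.finset_and (φ := fun i x => x i) (fun i => h.clone.proj f.1 i) (hne s)) htne
  convert hmem using 1
  refine Sigma.ext rfl (heq_of_eq ?_)
  funext x
  rw [Bool.eq_iff_iff]
  simp only [decide_eq_true_iff]
  constructor
  · intro hx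
    have := ht (show x ∈ f.2 ⁻¹' {true} from hx)
    simp only [Set.mem_iUnion] at this
    obtain ⟨s, hs, hxs⟩ := this
    exact ⟨s, hs, fun i hi => hxs i hi⟩
  · rintro ⟨s, -, hxs⟩
    refine mono_true hi.1 (fun i hi => ?_) s.2
    exact hxs i (by simpa using hi)

theorem classify (h : Over F) : F = P1 ∨ F = P2 ∨ F = P3 ∨ F = P4 ∨ F = P5 ∨ F = P6 ∨ F = P7 ∨
    F = P8 ∨ F = P9 := by
  have hB := h.subset_base
  by_cases hI : ∀ f ∈ F, IncrCont f
  · by_cases hD : ∀ f ∈ F, DecrCont f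
    · have : F = P9 :=
        Set.Subset.antisymm (fun f hf => ⟨hB hf, cont_of_incr_decr (hI f hf) (hD f hf)⟩) h.cont_subset
      tauto
    · push Not at hD
      obtain ⟨g, hg, hg'⟩ := hD
      have hao := h.hasAndOr hg hg'
      by_cases hV : ∀ f ∈ F, VanishNearBot f
      · have : F = P7 := by
          refine Set.Subset.antisymm (fun f hf => ⟨hB hf, hI f hf, hV f hf⟩) ?_
          rintro f ⟨hf, hf1, hf2⟩
          obtain ⟨v, hv, hfv⟩ := h.upper_of_vanish hf hf2
          exact h.mem_of_incr hao hf hf1 hv hfv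
        tauto
      · push Not at hV
        obtain ⟨k, hk, hk'⟩ := hV
        have : F = P3 := by
          refine Set.Subset.antisymm (fun f hf => ⟨hB hf, hI f hf⟩) ?_
          rintro f ⟨hf, hf1⟩
          obtain ⟨v, hv, hfv⟩ := h.upper_of_hasOr (h.hasOr hk hk') hf
          exact h.mem_of_incr hao hf hf1 hv hfv
        tauto
  · push Not at hI
    obtain ⟨g', hg', hg'1⟩ := hI
    have hoa := h.hasOrAnd hg' hg'1
    by_cases hD : ∀ f ∈ F, DecrCont f
    · by_cases hO : ∀ f ∈ F, OneNearTop f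
      · have : F = P8 := by
          refine Set.Subset.antisymm (fun f hf => ⟨hB hf, hD f hf, hO f hf⟩) ?_
          rintro f ⟨hf, hf1, hf2⟩
          obtain ⟨v, hv, hfv⟩ := h.lower_of_one hf hf2
          exact h.mem_of_decr hoa hf hf1 hv hfv
        tauto
      · push Not at hO
        obtain ⟨k, hk, hk'⟩ := hO
        have : F = P5 := by
          refine Set.Subset.antisymm (fun f hf => ⟨hB hf, hD f hf⟩) ?_
          rintro f ⟨hf, hf1⟩
          obtain ⟨v, hv, hfv⟩ := h.lower_of_hasAnd (h.hasAnd hk hk') hf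
          exact h.mem_of_decr hoa hf hf1 hv hfv
        tauto
    · push Not at hD
      obtain ⟨g, hg, hg1⟩ := hD
      have hao := h.hasAndOr hg hg1
      by_cases hV : ∀ f ∈ F, VanishNearBot f
      · by_cases hO : ∀ f ∈ F, OneNearTop f
        · have : F = P6 := by
            refine Set.Subset.antisymm (fun f hf => ⟨hB hf, hV f hf, hO f hf⟩) ?_
            rintro f ⟨hf, hf1, hf2⟩
            obtain ⟨u, hu, hfu⟩ := h.lower_of_one hf hf2
            obtain ⟨v, hv, hfv⟩ := h.upper_of_vanish hf hf1
            exact h.mem_of_between hao hoa hf hu hv hfu hfv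
          tauto
        · push Not at hO
          obtain ⟨k, hk, hk'⟩ := hO
          have : F = P4 := by
            refine Set.Subset.antisymm (fun f hf => ⟨hB hf, hV f hf⟩) ?_
            rintro f ⟨hf, hf1⟩
            obtain ⟨u, hu, hfu⟩ := h.lower_of_hasAnd (h.hasAnd hk hk') hf
            obtain ⟨v, hv, hfv⟩ := h.upper_of_vanish hf hf1
            exact h.mem_of_between hao hoa hf hu hv hfu hfv
          tauto
      · push Not at hV
        obtain ⟨k', hk1, hk2⟩ := hV
        by_cases hO : ∀ f ∈ F, OneNearTop f
        · have : F = P2 := by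
            refine Set.Subset.antisymm (fun f hf => ⟨hB hf, hO f hf⟩) ?_
            rintro f ⟨hf, hf2⟩
            obtain ⟨u, hu, hfu⟩ := h.lower_of_one hf hf2
            obtain ⟨v, hv, hfv⟩ := h.upper_of_hasOr (h.hasOr hk1 hk2) hf
            exact h.mem_of_between hao hoa hf hu hv hfu hfv
          tauto
        · push Not at hO
          obtain ⟨k, hk, hk'⟩ := hO
          have : F = P1 := by
            refine Set.Subset.antisymm (fun f hf => hB hf) ?_
            intro f hf
            obtain ⟨u, hu, hfu⟩ := h.lower_of_hasAnd (h.hasAnd hk hk') hf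
            obtain ⟨v, hv, hfv⟩ := h.upper_of_hasOr (h.hasOr hk1 hk2) hf
            exact h.mem_of_between hao hoa hf hu hv hfu hfv
          tauto

end Over

/-! ### The nine clones are distinct -/

noncomputable def orF : BFun := ⟨none, bigOr⟩
noncomputable def andF : BFun := ⟨none, bigAnd⟩
noncomputable def aoF : BFun := ⟨none, fun x : ℕ → Bool => x 0 && decide (∃ i, x (i + 1) = true)⟩
noncomputable def oaF : BFun := ⟨none, fun x : ℕ → Bool => x 0 || decide (∀ i, x (i + 1) = true)⟩

theorem meas_coord (i : ℕ) : MeasurableSet {x : ℕ → Bool | x i = true} := by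
  have hc : Measurable (fun x : ℕ → Bool => x i) := measurable_pi_apply i
  exact hc (measurableSet_singleton true)

theorem orF_base : orF ∈ Base := by
  refine ⟨?_, ?_, ?_, ?_⟩
  · have : MeasurableSet (⋃ i, {x : ℕ → Bool | x i = true}) := MeasurableSet.iUnion meas_coord
    refine (congrArg MeasurableSet (Set.ext fun x : ℕ → Bool => ?_)).mp this
    simp [orF, bigOr]
  · refine mono_of_true fun (x y : ℕ → Bool) hxy hx => ?_
    simp only [orF, bigOr, decide_eq_true_iff] at hx ⊢
    exact hx.imp fun i hi => hxy i hi
  · simp [PresBot, orF, bigOr]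
  · simp [PresTop, orF, bigOr]

theorem andF_base : andF ∈ Base := by
  refine ⟨?_, ?_, ?_, ?_⟩
  · have : MeasurableSet (⋂ i, {x : ℕ → Bool | x i = true}) := MeasurableSet.iInter meas_coord
    refine (congrArg MeasurableSet (Set.ext fun x : ℕ → Bool => ?_)).mp this
    simp [andF, bigAnd]
  · refine mono_of_true fun (x y : ℕ → Bool) hxy hx => ?_
    simp only [andF, bigAnd, decide_eq_true_iff] at hx ⊢
    exact fun i => hxy i (hx i)
  · simp [PresBot, andF, bigAnd]
  · simp [PresTop, andF, bigAnd]

theorem aoF_base : aoF ∈ Base := by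
  refine ⟨?_, ?_, ?_, ?_⟩
  · have : MeasurableSet ({x : ℕ → Bool | x 0 = true} ∩ ⋃ i, {x : ℕ → Bool | x (i + 1) = true}) :=
      (meas_coord 0).inter (MeasurableSet.iUnion fun i => meas_coord (i + 1))
    refine (congrArg MeasurableSet (Set.ext fun x : ℕ → Bool => ?_)).mp this
    simp [aoF]
  · refine mono_of_true fun (x y : ℕ → Bool) hxy hx => ?_
    simp only [aoF, Bool.and_eq_true, decide_eq_true_iff] at hx ⊢
    exact ⟨hxy (0 : ℕ) hx.1, hx.2.imp fun i hi => hxy (i + 1) hi⟩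
  · simp [PresBot, aoF]
  · simp [PresTop, aoF]

theorem oaF_base : oaF ∈ Base := by
  refine ⟨?_, ?_, ?_, ?_⟩
  · have : MeasurableSet ({x : ℕ → Bool | x 0 = true} ∪ ⋂ i, {x : ℕ → Bool | x (i + 1) = true}) :=
      (meas_coord 0).union (MeasurableSet.iInter fun i => meas_coord (i + 1))
    refine (congrArg MeasurableSet (Set.ext fun x : ℕ → Bool => ?_)).mp this
    simp [oaF]
  · refine mono_of_true fun (x y : ℕ → Bool) hxy hx => ?_
    simp only [oaF, Bool.or_eq_true, decide_eq_true_iff] at hx ⊢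
    exact hx.imp (fun h => hxy (0 : ℕ) h) fun h i => hxy (i + 1) (h i)
  · simp [PresBot, oaF]
  · simp [PresTop, oaF]

theorem orF_incr : IncrCont orF := by
  rw [incr_iff orF_base.2.1]
  intro (x : ℕ → ℕ → Bool) hx h
  simp only [orF, bigOr, decide_eq_true_iff] at h ⊢
  obtain ⟨i, q, hq⟩ := h
  exact ⟨q, i, hq⟩

theorem aoF_incr : IncrCont aoF := by
  rw [incr_iff aoF_base.2.1]
  intro (x : ℕ → ℕ → Bool) hx h
  simp only [aoF, Bool.and_eq_true, decide_eq_true_iff] at h ⊢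
  obtain ⟨⟨r, hr⟩, i, q, hq⟩ := h
  exact ⟨max r q, hx (le_max_left r q) (0 : ℕ) hr, i, hx (le_max_right r q) (i + 1) hq⟩

theorem andF_decr : DecrCont andF := by
  rw [decr_iff andF_base.2.1]
  intro (x : ℕ → ℕ → Bool) hx h
  simp only [andF, bigAnd, decide_eq_false_iff_not, decide_eq_true_iff] at h ⊢
  push Not at h ⊢
  obtain ⟨i, q, hq⟩ := h
  exact ⟨q, i, hq⟩

theorem oaF_decr : DecrCont oaF := by
  rw [decr_iff oaF_base.2.1]
  intro (x : ℕ → ℕ → Bool) hx h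
  simp only [oaF, Bool.or_eq_false_iff, decide_eq_false_iff_not, decide_eq_true_iff] at h ⊢
  push Not at h ⊢
  obtain ⟨⟨r, hr⟩, i, q, hq⟩ := h
  refine ⟨max r q, ?_, i, fun h => hq (hx (le_max_right r q) (i + 1) h)⟩
  rw [← Bool.not_eq_true]
  exact fun h => hr (hx (le_max_left r q) (0 : ℕ) h)

theorem orF_not_vanish : ¬ VanishNearBot orF := by
  rw [vanish_iff]
  rintro ⟨(s : Finset ℕ), hs⟩
  obtain ⟨n, hn⟩ := Infinite.exists_notMem_finset s
  have := hs (fun i : ℕ => decide (i = n)) (by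
    intro (i : ℕ) hi
    simp only [decide_eq_false_iff_not]
    rintro rfl
    exact hn hi)
  simp [orF, bigOr] at this

theorem andF_not_one : ¬ OneNearTop andF := by
  rw [one_iff]
  rintro ⟨(s : Finset ℕ), hs⟩
  obtain ⟨n, hn⟩ := Infinite.exists_notMem_finset s
  have := hs (fun i : ℕ => decide (i ≠ n)) (by
    intro (i : ℕ) hi
    simp only [decide_eq_true_iff]
    rintro rfl
    exact hn hi)
  simp [andF, bigAnd] at this

theorem aoF_vanish : VanishNearBot aoF := by
  rw [vanish_iff]
  refine ⟨({0} : Finset ℕ), fun (x : ℕ → Bool) hx => ?_⟩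
  have : x 0 = false := hx (0 : ℕ) (Finset.mem_singleton_self (0 : ℕ))
  simp [aoF, this]

theorem oaF_one : OneNearTop oaF := by
  rw [one_iff]
  refine ⟨({0} : Finset ℕ), fun (x : ℕ → Bool) hx => ?_⟩
  have : x 0 = true := hx (0 : ℕ) (Finset.mem_singleton_self (0 : ℕ))
  simp [oaF, this]

theorem aoF_not_decr : ¬ DecrCont aoF := by
  rw [decr_iff aoF_base.2.1]
  intro h
  obtain ⟨q, hq⟩ := h (fun q (i : ℕ) => decide (i = 0 ∨ q < i)) (by
    intro q r hqr (i : ℕ) hi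
    simp only [decide_eq_true_iff] at hi ⊢
    omega) (by
    simp only [aoF, decide_eq_true_iff, Bool.and_eq_false_iff, decide_eq_false_iff_not]
    right
    rintro ⟨i, hi⟩
    have := hi (i + 1)
    omega)
  simp only [aoF, decide_eq_true_iff, Bool.and_eq_false_iff, decide_eq_false_iff_not] at hq
  rcases hq with hq | hq
  · simp at hq
  · exact hq ⟨q, by omega⟩

theorem oaF_not_incr : ¬ IncrCont oaF := by
  rw [incr_iff oaF_base.2.1]
  intro h
  obtain ⟨q, hq⟩ := h (fun q (i : ℕ) => decide (i ≠ 0 ∧ i < q)) (by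
    intro q r hqr (i : ℕ) hi
    simp only [decide_eq_true_iff] at hi ⊢
    omega) (by
    simp only [oaF, decide_eq_true_iff, Bool.or_eq_true]
    right
    intro i
    exact ⟨i + 2, by omega, by omega⟩)
  simp only [oaF, decide_eq_true_iff, Bool.or_eq_true] at hq
  rcases hq with hq | hq
  · omega
  · have := hq q
    omega

noncomputable def sig (C : Set BFun) : Bool × Bool × Bool × Bool :=
  (decide (orF ∈ C), decide (andF ∈ C), decide (aoF ∈ C), decide (oaF ∈ C))

theorem part_two : List.Pairwise (· ≠ ·) [P1, P2, P3, P4, P5, P6, P7, P8, P9] := by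
  have a1 := orF_base
  have a2 := orF_incr
  have a3 := orF_not_vanish
  have a4 := one_of_incr a2 a1.2.2.2
  have a5 : ¬ DecrCont orF := fun h => a3 (vanish_of_decr h a1.2.2.1)
  have a6 : ¬ IsContFun orF := fun h => a5 (decr_of_cont a1.2.1 h)
  have b1 := andF_base
  have b2 := andF_decr
  have b3 := andF_not_one
  have b4 := vanish_of_decr b2 b1.2.2.1
  have b5 : ¬ IncrCont andF := fun h => b3 (one_of_incr h b1.2.2.2)
  have b6 : ¬ IsContFun andF := fun h => b5 (incr_of_cont b1.2.1 h)
  have c1 := aoF_base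
  have c2 := aoF_incr
  have c3 := aoF_vanish
  have c4 := one_of_incr c2 c1.2.2.2
  have c5 := aoF_not_decr
  have c6 : ¬ IsContFun aoF := fun h => c5 (decr_of_cont c1.2.1 h)
  have d1 := oaF_base
  have d2 := oaF_decr
  have d3 := oaF_one
  have d4 := vanish_of_decr d2 d1.2.2.1
  have d5 := oaF_not_incr
  have d6 : ¬ IsContFun oaF := fun h => d5 (incr_of_cont d1.2.1 h)
  refine List.Pairwise.of_map (S := (· ≠ ·)) sig (fun a b h h' => h (by rw [h'])) ?_
  simp [sig, P1, P2, P3, P4, P5, P6, P7, P8, P9, a1, a2, a3, a4, a5, a6, b1, b2, b3, b4, b5, b6,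
    c1, c2, c3, c4, c5, c6, d1, d2, d3, d4, d5, d6]

/-- There are exactly nine Borel clones whose finitary restriction is the set of all
finitary monotone `f` with `f(0⃗) = 0` and `f(1⃗) = 1`. -/
theorem borel_clones_over_MonoT0T1 :
    (∀ C ∈ [P1, P2, P3, P4, P5, P6, P7, P8, P9], IsClone C ∧ C ⊆ BorelClass ∧
      finRes C = {f | finitary f ∧ Monotone f.2 ∧ PresBot f ∧ PresTop f}) ∧
    List.Pairwise (· ≠ ·) [P1, P2, P3, P4, P5, P6, P7, P8, P9] ∧
    (∀ F : Set BFun, IsClone F → F ⊆ BorelClass →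
      finRes F = {f | finitary f ∧ Monotone f.2 ∧ PresBot f ∧ PresTop f} →
      F = P1 ∨ F = P2 ∨ F = P3 ∨ F = P4 ∨ F = P5 ∨ F = P6 ∨ F = P7 ∨ F = P8 ∨ F = P9) := by
  exact ⟨part_one, part_two, fun F h1 h2 h3 => Over.classify ⟨h1, h2, h3⟩⟩
end

section
/- Let 0 ≤ t ≤ k < ω with k ≥ 1, let 1 ≤ n ≤ ω, and let f : 2^n → 2 be a function with f ∉ Limm0kt. Then ∀₂^{k−t} ⊔ liminf^{⊔t} ∈ ⟨f, ⋀, ⌈⋁⌉⟩, where ⋀ : 2^ω → 2 is countably infinite conjunction and ⌈⋁⌉ : 2^ω → 2 is (x₀,x₁,x₂,…) ↦ x₀ ∧ ⋁_{i≥1} x_i. -/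
open scoped Classical

/-- `f ∈ Limm0kt`: there do not exist `k−t` elements of `f⁻¹(1)` together with `t`
elements of the closure of `f⁻¹(1)` whose coordinatewise meet is `0⃗`. -/
def MemLimm (k t : ℕ) {a : Arity} (f : (Idx a → Bool) → Bool) : Prop :=
  ¬ ∃ (x : Fin (k - t) → Idx a → Bool) (y : Fin t → Idx a → Bool),
      (∀ r, f (x r) = true) ∧ (∀ s, y s ∈ closure {z | f z = true}) ∧
      (∀ i : Idx a, (∃ r, x r i = false) ∨ (∃ s, y s i = false))

/-- `∀₂` on an arbitrary index type: `1` iff at most one coordinate is `0`. -/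
noncomputable def atMostOneFalse {ι : Type} (y : ι → Bool) : Bool :=
  decide (∀ i j : ι, y i = false → y j = false → i = j)

/-- For `0 < t ≤ k`, the function `∀₂^{k−t} ⊔ liminf^{⊔t} : 2^ω → 2`, via the coding of
`2^{(k−t)+t×ω}` as `2^ω` sending the plain variables to positions `j < k−t` and the
`(r,q)`-th block variable (for `k−t ≤ r < k`, `q < ω`) to position `(k−t) + q·t + (r−(k−t))`:
it is `1` iff at most one of the `k` bits `x_0, …, x_{k−t−1}, ⋀_q x_{k−t,q}, …, ⋀_q x_{k−1,q}`
is `0`, and moreover all but finitely many of the bits are `1`. -/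
noncomputable def sqcupFn (k t : ℕ) : (ℕ → Bool) → Bool := fun x =>
  (atMostOneFalse (fun i : Fin k =>
    if (i : ℕ) < k - t then x (i : ℕ)
    else decide (∀ q : ℕ, x ((k - t) + q * t + ((i : ℕ) - (k - t))) = true)))
  && liminfF x

/-- `∀₂^{k−t} ⊔ liminf^{⊔t}` as a Boolean function: of arity `k` (equal to `∀^k₂`) when
`t = 0`, and of arity `ω` when `t > 0`. -/
noncomputable def sqcupBF (k : ℕ+) (t : ℕ) : BFun :=
  if t = 0 then ⟨some k, fun x => atMostOneFalse x⟩ else ⟨none, sqcupFn k t⟩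

/-- `⌈⋁⌉ : 2^ω → 2`, `(x₀, x₁, x₂, …) ↦ x₀ ∧ ⋁_{i ≥ 1} x_i`. -/
noncomputable def ceilBigOr : (ℕ → Bool) → Bool :=
  fun x => x 0 && decide (∃ i, 1 ≤ i ∧ x i = true)

/-- Closure properties of a collection of predicates under `f`, `⋀`, `⌈⋁⌉`. -/
structure GoodM {X n : Type} (f : (n → Bool) → Bool) (M : (X → Prop) → Prop) : Prop where
  all : ∀ P : ℕ → X → Prop, (∀ i, M (P i)) → M (fun x => ∀ i, P i x)
  ceil : ∀ (A : X → Prop) (P : ℕ → X → Prop), M A → (∀ i, M (P i)) →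
    M (fun x => A x ∧ ∃ i, P i x)
  app : ∀ W : n → X → Prop, (∀ i, M (W i)) → M (fun x => f (fun i => decide (W i x)) = true)

namespace GoodM
variable {X n : Type} {f : (n → Bool) → Bool} {M : (X → Prop) → Prop}

theorem congr' {P Q : X → Prop} (h : M P) (e : ∀ x, P x ↔ Q x) : M Q := by
  have : P = Q := funext fun x => propext (e x)
  exact this ▸ h

theorem forallC (h : GoodM f M) {ι : Type} [Countable ι] [Nonempty ι] (P : ι → X → Prop)
    (hP : ∀ i, M (P i)) : M (fun x => ∀ i, P i x) := by
  obtain ⟨e, he⟩ := exists_surjective_nat ι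
  exact congr' (h.all (fun k => P (e k)) fun k => hP _) fun x =>
    (he.forall (p := fun i => P i x)).symm

theorem existsC (h : GoodM f M) {ι : Type} [Countable ι] [Nonempty ι] {A : X → Prop}
    (P : ι → X → Prop) (hA : M A)
    (hP : ∀ i, M (P i)) : M (fun x => A x ∧ ∃ i, P i x) := by
  obtain ⟨e, he⟩ := exists_surjective_nat ι
  exact congr' (h.ceil A (fun k => P (e k)) hA fun k => hP _) fun x => by
    rw [he.exists (p := fun i => P i x)]

theorem and (h : GoodM f M) {P Q : X → Prop} (hP : M P) (hQ : M Q) :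
    M (fun x => P x ∧ Q x) := by
  refine congr' (h.forallC (fun b : Bool => if b then P else Q) ?_) ?_
  · intro b; cases b <;> simpa
  · intro x; simp [and_comm]

theorem andForall (h : GoodM f M) {ι : Type} [Countable ι] {A : X → Prop}
    (P : ι → X → Prop) (hA : M A)
    (hP : ∀ i, M (fun x => A x ∧ P i x)) : M (fun x => A x ∧ ∀ i, P i x) := by
  rcases isEmpty_or_nonempty ι with hι | hι
  · exact congr' hA fun x => by simp
  · refine congr' (h.forallC _ hP) fun x => ?_
    exact forall_and_left _ _

theorem andImp {A Q : X → Prop} (c : Prop) (hA : M A)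
    (hQ : c → M (fun x => A x ∧ Q x)) : M (fun x => A x ∧ (c → Q x)) := by
  by_cases hc : c
  · exact congr' (hQ hc) fun x => by simp [hc]
  · exact congr' hA fun x => by simp [hc]

theorem andOr (h : GoodM f M) {A P Q : X → Prop} (hA : M A) (hP : M P) (hQ : M Q) :
    M (fun x => A x ∧ (P x ∨ Q x)) := by
  refine congr' (h.existsC (fun b : Bool => if b then P else Q) hA ?_) ?_
  · intro b; cases b <;> simpa
  · intro x; simp [or_comm]

/-- Any upper bound of the target gives the constant-one, monotone or implication case. -/
theorem trichotomy (h : GoodM f M) (P₀ : X → Prop) (h0 : M P₀) (z : n → Bool) (hz : f z = true) :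
    M (fun _ => True) ∨ (f (fun _ => true) = true ∧ ∀ v w, v ≤ w → f v = true → f w = true) ∨
    ((∀ A P Q : X → Prop, M A → M P → M Q → M (fun x => A x ∧ (P x → Q x))) ∧
      (f (fun _ => true) = true ∨
        ∀ A P : X → Prop, M A → M P → M (fun x => A x ∧ ¬ P x))) := by
  have diag := h.app (fun _ => P₀) (fun _ => h0)
  by_cases f0 : f (fun _ => false) = true
  · left
    by_cases f1 : f (fun _ => true) = true
    · refine congr' diag fun x => ?_
      by_cases hx : P₀ x <;> simp [hx, f0, f1]
    · have neg : ∀ P, M P → M (fun x => ¬ P x) := fun P hP => by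
        refine congr' (h.app (fun _ => P) (fun _ => hP)) fun x => ?_
        by_cases hx : P x <;> simp [hx, f0, f1]
      exact congr' (neg _ (h.and h0 (neg _ h0))) fun x => by tauto
  right
  by_cases f1 : f (fun _ => true) = true
  · by_cases hm : ∀ v w, v ≤ w → f v = true → f w = true
    · exact Or.inl ⟨f1, hm⟩
    right
    refine ⟨?_, Or.inl f1⟩
    push Not at hm
    obtain ⟨v, w, hvw, hv, hw⟩ := hm
    intro A P Q hA hP hQ
    have hAP := h.and hA hP
    have hAPQ := h.and hAP hQ
    have := h.app (fun i => if v i = true then A else if w i = true then (fun x => A x ∧ P x)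
      else (fun x => (A x ∧ P x) ∧ Q x)) (fun i => by split_ifs <;> assumption)
    refine congr' (h.and hA this) fun x => ?_
    refine and_congr_right fun hAx => ?_
    by_cases hPx : P x
    · by_cases hQx : Q x
      · have : (fun i => decide ((if v i = true then A else if w i = true then
          (fun x => A x ∧ P x) else (fun x => (A x ∧ P x) ∧ Q x)) x)) = fun _ => true := by
          funext i; split_ifs <;> simp [*]
        rw [this]; simp [*]
      · have : (fun i => decide ((if v i = true then A else if w i = true then
          (fun x => A x ∧ P x) else (fun x => (A x ∧ P x) ∧ Q x)) x)) = w := by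
          funext i
          have := hvw i
          split_ifs with h1 h2
          · rw [h1] at this; simp [hAx]; exact Bool.eq_true_of_true_le this
          · simp [*]
          · simp [*]
        rw [this]; simp [*]
    · have : (fun i => decide ((if v i = true then A else if w i = true then
          (fun x => A x ∧ P x) else (fun x => (A x ∧ P x) ∧ Q x)) x)) = v := by
        funext i
        split_ifs with h1 h2 <;> simp [*]
      rw [this]; simp [*]
  · right
    have diff : ∀ A P : X → Prop, M A → M P → M (fun x => A x ∧ ¬ P x) := by
      intro A P hA hP
      have hAP := h.and hA hP
      have := h.app (fun i => if z i = true then A else (fun x => A x ∧ P x))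
        (fun i => by split_ifs <;> assumption)
      refine congr' (h.and hA this) fun x => ?_
      refine and_congr_right fun hAx => ?_
      by_cases hPx : P x
      · have : (fun i => decide ((if z i = true then A else (fun x => A x ∧ P x)) x))
            = fun _ => true := by
          funext i; split_ifs <;> simp [*]
        rw [this]; simp [*]
      · have : (fun i => decide ((if z i = true then A else (fun x => A x ∧ P x)) x)) = z := by
          funext i; split_ifs <;> simp [*]
        rw [this]; simp [*]
    refine ⟨fun A P Q hA hP hQ => ?_, Or.inr diff⟩
    exact congr' (diff A _ hA (diff P Q hP hQ)) fun x => by tauto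

/-- The bad indices. -/
def Bad {P S : Type} (a : P → X → Prop) (b : S → ℕ → X → Prop) (u : X) : P ⊕ S → Prop
  | Sum.inl r => ¬ a r u
  | Sum.inr s => ∃ q, ¬ b s q u

/-- The target predicate. -/
def Tgt {P S : Type} (a : P → X → Prop) (b : S → ℕ → X → Prop) (u : X) : Prop :=
  (∀ i j, Bad a b u i → Bad a b u j → i = j) ∧ ∀ s, ∃ N, ∀ q, b s (N + q) u

/-- On the target, either nothing is bad, one plain index is bad, or one block is bad with
a last zero. -/
theorem tgt_cases {P S : Type} {a : P → X → Prop} {b : S → ℕ → X → Prop} {u : X}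
    (h : Tgt a b u) :
    ((∀ r, a r u) ∧ ∀ s q, b s q u) ∨
    (∃ r₀, ¬ a r₀ u ∧ (∀ r, r ≠ r₀ → a r u) ∧ ∀ s q, b s q u) ∨
    (∃ s₀ q₀, ¬ b s₀ q₀ u ∧ (∀ q, q₀ < q → b s₀ q u) ∧ (∀ r, a r u) ∧
      ∀ s, s ≠ s₀ → ∀ q, b s q u) := by
  obtain ⟨h1, h2⟩ := h
  by_cases hA : ∃ r₀, ¬ a r₀ u
  · right; left
    obtain ⟨r₀, hr⟩ := hA
    refine ⟨r₀, hr, fun r hne => ?_, fun s q => ?_⟩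
    · by_contra hc
      exact hne (Sum.inl.inj (h1 (Sum.inl r) (Sum.inl r₀) hc hr))
    · by_contra hc
      have := h1 (Sum.inl r₀) (Sum.inr s) hr ⟨q, hc⟩
      cases this
  · push Not at hA
    by_cases hB : ∃ s₀, ∃ q, ¬ b s₀ q u
    · right; right
      obtain ⟨s₀, hs⟩ := hB
      obtain ⟨N, hN⟩ := h2 s₀
      have hbd : ∀ q, ¬ b s₀ q u → q ≤ N := by
        intro q hq
        by_contra hc
        apply hq
        have := hN (q - N)
        rwa [Nat.add_sub_cancel' (by omega)] at this
      obtain ⟨q, hq⟩ := hs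
      refine ⟨s₀, Nat.findGreatest (fun q => ¬ b s₀ q u) N,
        Nat.findGreatest_spec (P := fun q => ¬ b s₀ q u) (hbd q hq) hq, fun q' hq' => ?_, hA,
        fun s hne q' => ?_⟩
      · by_contra hc
        exact Nat.findGreatest_is_greatest hq' (hbd _ hc) hc
      · by_contra hc
        exact hne (Sum.inr.inj (h1 (Sum.inr s) (Sum.inr s₀) ⟨q', hc⟩ ⟨q, hq⟩))
    · push Not at hB
      exact Or.inl ⟨hA, hB⟩

theorem tgt_of_upper (h : GoodM f M) {P S : Type} [Countable P] [Countable S]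
    {a : P → X → Prop} {b : S → ℕ → X → Prop} (ha : ∀ r, M (a r)) (hb : ∀ s q, M (b s q))
    {A : X → Prop} (hA : M A) (hT : ∀ u, Tgt a b u → A u) : M (Tgt a b) := by
  have hgood : ∀ i, M (fun u => ¬ Bad a b u i) := by
    rintro (r | s)
    · exact congr' (ha r) fun u => by simp [Bad]
    · exact congr' (h.forallC (b s) (hb s)) fun u => by simp [Bad]
  have h1 := h.andForall (A := A) (fun i u => ∀ j, i ≠ j → (¬ Bad a b u i ∨ ¬ Bad a b u j)) hA
    (fun i => h.andForall _ hA fun j => andImp _ hA fun _ => h.andOr hA (hgood i) (hgood j))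
  have h2 := h.andForall (A := A) (fun s u => ∃ N, ∀ q, b s (N + q) u) hA
    (fun s => h.existsC _ hA fun N => h.forallC _ fun q => hb s (N + q))
  refine congr' (h.and h1 h2) fun u => ?_
  constructor
  · rintro ⟨⟨_, h1⟩, _, h2⟩
    refine ⟨fun i j hi hj => ?_, h2⟩
    by_contra hne
    have := h1 i j hne
    tauto
  · intro hu
    refine ⟨⟨hT u hu, fun i j hne => ?_⟩, hT u hu, hu.2⟩
    have := hu.1 i j
    tauto

/-- The monotone substitution. -/
def WW {P S : Type} (a : P → X → Prop) (b : S → ℕ → X → Prop) (x : P → n → Bool)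
    (z : S → ℕ → n → Bool) (i : n) (u : X) : Prop :=
  (∀ r, x r i = false → a r u) ∧ ∀ s q, (∀ p, q ≤ p → z s p i = false) → b s q u

theorem upper (h : GoodM f M) {P S : Type} [Countable P] [Countable S] [Nonempty (P ⊕ S)]
    {a : P → X → Prop} {b : S → ℕ → X → Prop} (ha : ∀ r, M (a r)) (hb : ∀ s q, M (b s q))
    (x : P → n → Bool) (z : S → ℕ → n → Bool) (hx : ∀ r, f (x r) = true)
    (hz : ∀ s q, f (z s q) = true)
    (hm : ∀ i, (∃ r, x r i = false) ∨ ∃ s N, ∀ p, N ≤ p → z s p i = false) :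
    ∃ A, M A ∧ ∀ u, Tgt a b u → A u := by
  obtain ⟨P₀, hP₀, z₀, hz₀⟩ : ∃ P₀, M P₀ ∧ ∃ z₀, f z₀ = true := by
    obtain ⟨r | s⟩ := ‹Nonempty (P ⊕ S)›
    · exact ⟨_, ha r, _, hx r⟩
    · exact ⟨_, hb s 0, _, hz s 0⟩
  let W : n → X → Prop := WW a b x z
  have hW : ∀ i, M (W i) := by
    intro i
    obtain ⟨B, hB, hBW⟩ : ∃ B, M B ∧ ∀ u, W i u → B u := by
      rcases hm i with ⟨r, hr⟩ | ⟨s, N, hN⟩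
      · exact ⟨_, ha r, fun u hu => hu.1 r hr⟩
      · exact ⟨_, hb s N, fun u hu => hu.2 s N hN⟩
    have h1 := h.andForall (A := B) (fun r u => x r i = false → a r u) hB
      (fun r => andImp _ hB fun _ => h.and hB (ha r))
    have h2 := h.andForall (A := B)
      (fun s u => ∀ q, (∀ p, q ≤ p → z s p i = false) → b s q u) hB
      (fun s => h.andForall _ hB fun q => andImp _ hB fun _ => h.and hB (hb s q))
    refine congr' (h.and h1 h2) fun u => ?_
    exact ⟨fun hu => ⟨hu.1.2, hu.2.2⟩, fun hu => ⟨⟨hBW u hu, hu.1⟩, hBW u hu, hu.2⟩⟩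
  rcases h.trichotomy P₀ hP₀ z₀ hz₀ with ht | ⟨f1, mono⟩ | ⟨imp, hneg⟩
  · exact ⟨_, ht, fun _ _ => trivial⟩
  · refine ⟨_, h.app W hW, fun u hu => ?_⟩
    rcases tgt_cases hu with ⟨h1, h2⟩ | ⟨r₀, h0, h1, h2⟩ | ⟨s₀, q₀, h0, h0', h1, h2⟩
    · have : (fun i => decide (W i u)) = fun _ => true := by
        funext i
        exact decide_eq_true ⟨fun r _ => h1 r, fun s q _ => h2 s q⟩
      rw [this]; exact f1
    · refine mono _ _ ?_ (hx r₀)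
      intro i
      rw [Bool.le_iff_imp]
      intro hi
      refine decide_eq_true ⟨fun r hr => h1 r ?_, fun s q _ => h2 s q⟩
      rintro rfl
      simp [hi] at hr
    · refine mono _ _ ?_ (hz s₀ q₀)
      intro i
      rw [Bool.le_iff_imp]
      intro hi
      refine decide_eq_true ⟨fun r hr => h1 r, fun s q hq => ?_⟩
      by_cases hs : s = s₀
      · subst hs
        apply h0'
        by_contra hc
        have := hq q₀ (by omega)
        simp [hi] at this
      · exact h2 s hs q
  · -- the implication case
    let V : n → X → Prop := fun i u => W i u ∧
      ∀ s q, z s q i = false → ((∀ p, b s (q + 1 + p) u) → b s q u)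
    have hV : ∀ i, M (V i) := fun i =>
      h.andForall _ (hW i) fun s => h.andForall _ (hW i) fun q => andImp _ (hW i) fun _ =>
        imp _ _ _ (hW i) (h.forallC _ fun p => hb s (q + 1 + p)) (hb s q)
    obtain ⟨U, hU, z₁, hz₁, hU1, hU2⟩ : ∃ U : n → X → Prop, (∀ i, M (U i)) ∧ ∃ z₁ : n → Bool,
        f z₁ = true ∧ (∀ u, (∀ i, ¬ Bad a b u i) → ∀ i, V i u → (U i u ↔ z₁ i = true)) ∧
        (∀ u, (¬ ∀ i, ¬ Bad a b u i) → ∀ i, (U i u ↔ V i u)) := by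
      rcases hneg with f1 | diff
      · exact ⟨V, hV, fun _ => true, f1, fun u _ i hi => by simp [hi], fun u _ i => Iff.rfl⟩
      · have hgood : ∀ i, M (fun u => ¬ Bad a b u i) := by
          rintro (r | s)
          · exact congr' (ha r) fun u => by simp [Bad]
          · exact congr' (h.forallC (b s) (hb s)) fun u => by simp [Bad]
        have hall := h.forallC _ hgood
        refine ⟨fun i u => V i u ∧ (z₀ i = false → ¬ ∀ i, ¬ Bad a b u i),
          fun i => andImp _ (hV i) fun _ => diff _ _ (hV i) hall, z₀, hz₀, ?_, ?_⟩
        · intro u hu i hi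
          simp only [hi, hu]
          simp
        · intro u hu i
          tauto
    refine ⟨_, h.app U hU, fun u hu => ?_⟩
    rcases tgt_cases hu with ⟨h1, h2⟩ | ⟨r₀, h0, h1, h2⟩ | ⟨s₀, q₀, h0, h0', h1, h2⟩
    · have hb : ∀ i, ¬ Bad a b u i := by
        rintro (r | s)
        · simpa [Bad] using h1 r
        · simpa [Bad] using h2 s
      have : (fun i => decide (U i u)) = z₁ := by
        funext i
        have := hU1 u hb i ⟨⟨fun r _ => h1 r, fun s q _ => h2 s q⟩, fun s q _ _ => h2 s q⟩
        rw [Bool.eq_iff_iff]; simpa using this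
      rw [this]; exact hz₁
    · have hb : ¬ ∀ i, ¬ Bad a b u i := fun hc => hc (Sum.inl r₀) h0
      have : (fun i => decide (U i u)) = x r₀ := by
        funext i
        rw [Bool.eq_iff_iff, decide_eq_true_iff, hU2 u hb i]
        constructor
        · intro hv
          by_contra hc
          exact h0 (hv.1.1 r₀ (by simpa using hc))
        · intro hi
          refine ⟨⟨fun r hr => h1 r ?_, fun s q _ => h2 s q⟩, fun s q _ _ => h2 s q⟩
          rintro rfl
          simp [hi] at hr
      rw [this]; exact hx r₀
    · have hb : ¬ ∀ i, ¬ Bad a b u i := fun hc => hc (Sum.inr s₀) ⟨q₀, h0⟩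
      have : (fun i => decide (U i u)) = z s₀ q₀ := by
        funext i
        rw [Bool.eq_iff_iff, decide_eq_true_iff, hU2 u hb i]
        constructor
        · intro hv
          by_contra hc
          exact h0 (hv.2 s₀ q₀ (by simpa using hc) fun p => h0' _ (by omega))
        · intro hi
          refine ⟨⟨fun r hr => h1 r, fun s q hq => ?_⟩, fun s q hq hp => ?_⟩
          · by_cases hs : s = s₀
            · subst hs
              apply h0'
              by_contra hc
              have := hq q₀ (by omega)
              simp [hi] at this
            · exact h2 s hs q
          · by_cases hs : s = s₀
            · subst hs
              rcases lt_trichotomy q q₀ with hlt | rfl | hgt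
              · exfalso
                apply h0
                have := hp (q₀ - (q + 1))
                rwa [Nat.add_sub_cancel' (by omega)] at this
              · simp [hi] at hq
              · exact h0' q hgt
            · exact h2 s hs q
      rw [this]; exact hz s₀ q₀

end GoodM

theorem decT {p : Prop} {inst : Decidable p} : decide p = true ↔ p := decide_eq_true_iff

theorem goodM_of_clone {F : Set BFun} (hF : IsClone F) {a : Arity} {f : (Idx a → Bool) → Bool}
    (h1 : (⟨a, f⟩ : BFun) ∈ F) (h2 : (⟨none, bigAnd⟩ : BFun) ∈ F)
    (h3 : (⟨none, ceilBigOr⟩ : BFun) ∈ F) (b : Arity) :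
    GoodM f (fun P : (Idx b → Bool) → Prop => (⟨b, fun x => decide (P x)⟩ : BFun) ∈ F) := by
  refine ⟨fun P hP => ?_, fun A P hA hP => ?_, fun W hW => ?_⟩
  · have := hF.comp none b bigAnd (fun i x => decide (P i x)) h2 hP
    convert this using 3 with x
    simp [bigAnd]
  · have := hF.comp none b ceilBigOr
      (fun i x => decide ((if i = 0 then A else P (i - 1)) x)) h3 (fun i => by
        by_cases hi : i = 0
        · simpa [hi] using hA
        · simpa [hi] using hP (i - 1))
    convert this using 3 with x
    rw [Bool.eq_iff_iff]
    simp only [ceilBigOr, decide_eq_true_iff, Bool.and_eq_true, if_true]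
    refine and_congr_right fun _ => ⟨?_, ?_⟩
    · rintro ⟨i, hi⟩; exact ⟨i + 1, by omega, by simpa using hi⟩
    · rintro ⟨i, hi, h⟩
      rw [if_neg (Nat.one_le_iff_ne_zero.1 hi)] at h
      exact ⟨_, h⟩
  · have := hF.comp a b f (fun i x => decide (W i x)) h1 hW
    convert this using 3 with x
    rw [Bool.eq_iff_iff]; simp

theorem countable_idx (a : Arity) : Countable (Idx a) := by
  cases a <;> dsimp only [Idx] <;> infer_instance

theorem exists_seq_of_closure {n : Type} [Countable n] {f : (n → Bool) → Bool} {y : n → Bool}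
    (hy : y ∈ closure {z | f z = true}) :
    ∃ z : ℕ → n → Bool, (∀ q, f (z q) = true) ∧ ∀ i, ∃ N, ∀ q, N ≤ q → z q i = y i := by
  obtain ⟨z, hz, hl⟩ := mem_closure_iff_seq_limit.1 hy
  refine ⟨z, hz, fun i => ?_⟩
  have := (tendsto_pi_nhds.1 hl) i
  rw [nhds_discrete, Filter.tendsto_pure] at this
  exact Filter.eventually_atTop.1 this

theorem tgt_mem {F : Set BFun} (hF : IsClone F) {a : Arity} {f : (Idx a → Bool) → Bool}
    (h1 : (⟨a, f⟩ : BFun) ∈ F) (h2 : (⟨none, bigAnd⟩ : BFun) ∈ F)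
    (h3 : (⟨none, ceilBigOr⟩ : BFun) ∈ F) (b : Arity) {k t : ℕ} (hk : 0 < k) (ht : t ≤ k)
    (hf : ¬ MemLimm k t f) (α : Fin (k - t) → Idx b) (β : Fin t → ℕ → Idx b) :
    (⟨b, fun u => decide (GoodM.Tgt (fun r (u : Idx b → Bool) => u (α r) = true)
      (fun s q u => u (β s q) = true) u)⟩ : BFun) ∈ F := by
  have G := goodM_of_clone hF h1 h2 h3 b
  have := countable_idx a
  rw [MemLimm, not_not] at hf
  obtain ⟨x, y, hx, hy, hm⟩ := hf
  choose z hz hlim using fun s => exists_seq_of_closure (hy s)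
  have : Nonempty (Fin (k - t) ⊕ Fin t) := by
    rcases Nat.eq_zero_or_pos t with h | h
    · exact ⟨Sum.inl ⟨0, by omega⟩⟩
    · exact ⟨Sum.inr ⟨0, h⟩⟩
  have hproj : ∀ i : Idx b, (⟨b, fun x => @decide (x i = true)
      (Classical.propDecidable _)⟩ : BFun) ∈ F := fun i => by
    convert hF.proj b i using 3 with x
    rw [Bool.eq_iff_iff, decT]
  obtain ⟨A, hA, hAT⟩ := G.upper (a := fun r (u : Idx b → Bool) => u (α r) = true)
    (b := fun s q u => u (β s q) = true) (fun r => hproj _) (fun s q => hproj _) x z hx hz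
    (fun i => by
      rcases hm i with h | ⟨s, hs⟩
      · exact Or.inl h
      · obtain ⟨N, hN⟩ := hlim s i
        exact Or.inr ⟨s, N, fun p hp => (hN p hp).trans hs⟩)
  exact G.tgt_of_upper (fun r => hproj _) (fun s q => hproj _) hA hAT

/-- If `f` (of any arity `1 ≤ n ≤ ω`) does not lie in `Limm0kt`, then
`∀₂^{k−t} ⊔ liminf^{⊔t} ∈ ⟨f, ⋀, ⌈⋁⌉⟩`. -/
theorem sqcup_mem_cloneGen_of_not_memLimm (k : ℕ+) (t : ℕ) (ht : t ≤ (k : ℕ))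
    (a : Arity) (f : (Idx a → Bool) → Bool)
    (hf : ¬ MemLimm (k : ℕ) t f) :
    sqcupBF k t ∈
      cloneGen {(⟨a, f⟩ : BFun), (⟨none, bigAnd⟩ : BFun), (⟨none, ceilBigOr⟩ : BFun)} := by
  rintro F ⟨hF, hG⟩
  have h1 : (⟨a, f⟩ : BFun) ∈ F := hG (by simp)
  have h2 : (⟨none, bigAnd⟩ : BFun) ∈ F := hG (by simp)
  have h3 : (⟨none, ceilBigOr⟩ : BFun) ∈ F := hG (by simp)
  have hk : 0 < (k : ℕ) := k.pos
  unfold sqcupBF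
  by_cases h0 : t = 0
  · subst h0
    rw [if_pos rfl]
    have := tgt_mem hF h1 h2 h3 (some k) hk ht hf (fun r => (r : Fin (k : ℕ)))
      (fun s => s.elim0)
    convert this using 3 with u
    unfold atMostOneFalse
    rw [decide_eq_decide]
    constructor
    · intro h
      refine ⟨?_, fun s => s.elim0⟩
      rintro (i | s) (j | s')
      · intro hi hj
        simp only [GoodM.Bad, Bool.not_eq_true] at hi hj
        exact congrArg _ (h i j hi hj)
      · exact s'.elim0
      · exact s.elim0
      · exact s.elim0
    · intro h i j hi hj
      exact Sum.inl.inj (h.1 (Sum.inl i) (Sum.inl j) (by simpa [GoodM.Bad] using hi)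
        (by simpa [GoodM.Bad] using hj))
  · rw [if_neg h0]
    have := tgt_mem hF h1 h2 h3 none hk ht hf (fun r => (r : ℕ))
      (fun s q => ((k : ℕ) - t) + q * t + s)
    convert this using 3 with u
    unfold sqcupFn atMostOneFalse liminfF
    rw [Bool.eq_iff_iff, Bool.and_eq_true, decT, decT, decT]
    refine and_congr ?_ ?_
    · let e : Fin ((k : ℕ) - t) ⊕ Fin t → Fin (k : ℕ) := Sum.elim
        (fun r => ⟨r, by omega⟩) (fun s => ⟨(k : ℕ) - t + s, by omega⟩)
      have hinj : Function.Injective e := by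
        rintro (i | i) (j | j) hij <;> simp [e] at hij
        · exact congrArg _ (Fin.ext hij)
        · omega
        · omega
        · exact congrArg _ (Fin.ext hij)
      have hsurj : Function.Surjective e := by
        intro i
        by_cases hi : (i : ℕ) < k - t
        · exact ⟨Sum.inl ⟨i, hi⟩, rfl⟩
        · exact ⟨Sum.inr ⟨i - (k - t), by omega⟩, by ext; simp [e]; omega⟩
      rw [hsurj.forall]
      refine forall_congr' fun i => ?_
      rw [hsurj.forall]
      refine forall_congr' fun j => ?_
      have key : ∀ i, ((if ((e i : Fin (k : ℕ)) : ℕ) < (k : ℕ) - t then u ((e i : Fin (k : ℕ)) : ℕ)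
          else decide (∀ q : ℕ, u (((k : ℕ) - t) + q * t + ((e i : ℕ) - (k - t))) = true)) = false)
          ↔ GoodM.Bad (fun (r : Fin ((k : ℕ) - t)) (u : ℕ → Bool) => u r = true)
            (fun (s : Fin t) q u => u (((k : ℕ) - t) + q * t + s) = true) u i := by
        rintro (r | s)
        · simp [e, GoodM.Bad]
        · simp [e, GoodM.Bad]
      rw [key, key, hinj.eq_iff]
    · constructor
      · rintro ⟨N, hN⟩ s
        refine ⟨N, fun q => hN _ ?_⟩
        have : N + q ≤ (N + q) * t := Nat.le_mul_of_pos_right _ (by omega)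
        omega
      · intro h
        choose N hN using h
        refine ⟨(k - t) + (∑ s, N s) * t, fun j hj => ?_⟩
        have hlt : (j - (k - t)) % t < t := Nat.mod_lt _ (by omega)
        have hle : N ⟨_, hlt⟩ ≤ (j - (k - t)) / t := by
          refine (Finset.single_le_sum (fun _ _ => Nat.zero_le _) (Finset.mem_univ _)).trans
            ((Nat.le_div_iff_mul_le (by omega)).2 (by omega))
        have := hN ⟨_, hlt⟩ ((j - (k - t)) / t - N ⟨_, hlt⟩)
        rw [Nat.add_sub_cancel' hle] at this
        have e2 := Nat.div_add_mod' (j - ((k : ℕ) - t)) t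
        have e3 : ((k : ℕ) - t) + (j - (k - t)) / t * t + (j - (k - t)) % t = j := by omega
        simp only at this
        rwa [e3] at this
end
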